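/- Let N be a super nebula under an ordering θ such that every star of N under θ is a frontier star and every super 2-nebula of N under θ is a super middle 2-nebula, and let G be a central triangular galaxy under an ordering α having exactly one triangle under α. Then there exists ε > 0 such that every {N,G}-free tournament T contains a transitive subtournament of size at least |T|^ε. -/

import Mathlib

open Finset

/-- A tournament on vertex set `Fin n`: `adj u v` means there is an arc from `u` to `v`. -/
structure Tournament (n : ℕ) where
  adj : Fin n → Fin n → Prop
  asymm : ∀ u v, adj u v → ¬ adj v u
  total : ∀ u v, u ≠ v → adj u v ∨ adj v u

namespace Tournament

variable {n N : ℕ}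

/-- The position of vertex `v` in the ordering `θ`, where `θ k` is the `k`-th vertex. -/
def pos (θ : Equiv.Perm (Fin n)) (v : Fin n) : Fin n := θ.symm v

/-- The arc `u → v` of `T` is a backward arc under the ordering `θ`. -/
def Backward (T : Tournament n) (θ : Equiv.Perm (Fin n)) (u v : Fin n) : Prop :=
  T.adj u v ∧ pos θ v < pos θ u

/-- `x` lies strictly between two elements of `L` under the ordering `θ`. -/
def BetweenSet (θ : Equiv.Perm (Fin n)) (L : Finset (Fin n)) (x : Fin n) : Prop :=
  ∃ u ∈ L, ∃ w ∈ L, pos θ u < pos θ x ∧ pos θ x < pos θ w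

/-- The induced subtournament of `T` on `s` is transitive. -/
def IsTransOn (T : Tournament n) (s : Finset (Fin n)) : Prop :=
  ∀ u ∈ s, ∀ v ∈ s, ∀ w ∈ s, T.adj u v → T.adj v w → T.adj u w

/-- The largest size of a transitive subtournament of `T` contained in `s`. -/
noncomputable def trSizeOn (T : Tournament n) (s : Finset (Fin n)) : ℕ :=
  sSup {k | ∃ t, t ⊆ s ∧ T.IsTransOn t ∧ t.card = k}

/-- `tr(T)`: the largest size of a transitive subtournament of `T`. -/
noncomputable def trSize (T : Tournament n) : ℕ := T.trSizeOn Finset.univ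

/-- `T` contains `H`: some induced subtournament of `T` is isomorphic to `H`. -/
def Contains (T : Tournament N) (H : Tournament n) : Prop :=
  ∃ f : Fin n ↪ Fin N, ∀ u v, H.adj u v ↔ T.adj (f u) (f v)

/-- `T` is `ε`-critical. -/
def EpsCritical (T : Tournament n) (ε : ℝ) : Prop :=
  ((T.trSize : ℝ) < (n : ℝ) ^ ε) ∧
  ∀ s : Finset (Fin n), s ≠ Finset.univ → ((s.card : ℝ) ^ ε ≤ (T.trSizeOn s : ℝ))

/-- `S` with center `c` is a right star of `T` under `θ`. -/
def IsRightStarAt (T : Tournament n) (θ : Equiv.Perm (Fin n)) (S : Finset (Fin n))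
    (c : Fin n) : Prop :=
  c ∈ S ∧ (S.erase c).Nonempty ∧
  (∀ v ∈ S.erase c, pos θ v < pos θ c ∧ T.adj c v) ∧
  (∀ u ∈ S, ∀ v ∈ S, T.Backward θ u v → u = c)

/-- `S` with center `c` is a left star of `T` under `θ`. -/
def IsLeftStarAt (T : Tournament n) (θ : Equiv.Perm (Fin n)) (S : Finset (Fin n))
    (c : Fin n) : Prop :=
  c ∈ S ∧ (S.erase c).Nonempty ∧
  (∀ v ∈ S.erase c, pos θ c < pos θ v ∧ T.adj v c) ∧
  (∀ u ∈ S, ∀ v ∈ S, T.Backward θ u v → v = c)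

/-- `S` with center `c` is a middle star of `T` under `θ`. -/
def IsMiddleStarAt (T : Tournament n) (θ : Equiv.Perm (Fin n)) (S : Finset (Fin n))
    (c : Fin n) : Prop :=
  c ∈ S ∧
  (∃ v ∈ S.erase c, pos θ v < pos θ c) ∧ (∃ v ∈ S.erase c, pos θ c < pos θ v) ∧
  (∀ v ∈ S.erase c, (pos θ v < pos θ c → T.adj c v) ∧ (pos θ c < pos θ v → T.adj v c)) ∧
  (∀ u ∈ S, ∀ v ∈ S, T.Backward θ u v → u = c ∨ v = c)

def IsFrontierStarAt (T : Tournament n) (θ : Equiv.Perm (Fin n)) (S : Finset (Fin n))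
    (c : Fin n) : Prop :=
  T.IsLeftStarAt θ S c ∨ T.IsRightStarAt θ S c

def IsStarAt (T : Tournament n) (θ : Equiv.Perm (Fin n)) (S : Finset (Fin n))
    (c : Fin n) : Prop :=
  T.IsLeftStarAt θ S c ∨ T.IsRightStarAt θ S c ∨ T.IsMiddleStarAt θ S c

/-- A middle star with exactly one leaf after the center (center is `u_{p-1}`). -/
def IsOneRightMiddleStarAt (T : Tournament n) (θ : Equiv.Perm (Fin n)) (S : Finset (Fin n))
    (c : Fin n) : Prop :=
  T.IsMiddleStarAt θ S c ∧ ((S.erase c).filter (fun v => pos θ c < pos θ v)).card = 1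

/-- A middle star with exactly one leaf before the center (center is `u_2`). -/
def IsOneLeftMiddleStarAt (T : Tournament n) (θ : Equiv.Perm (Fin n)) (S : Finset (Fin n))
    (c : Fin n) : Prop :=
  T.IsMiddleStarAt θ S c ∧ ((S.erase c).filter (fun v => pos θ v < pos θ c)).card = 1

/-- Kinds of super 2-nebulas. -/
inductive NebKind
  | left
  | middle
  | right

/-- Common requirements on the data of a super 2-nebula: vertex set `S`, centers `c₁, c₂`
(`c₁` before `c₂` under `θ`), leaves `L₁` incident to `c₁` and `L₂` incident to `c₂`. -/
def Super2NebCommon (θ : Equiv.Perm (Fin n)) (S : Finset (Fin n)) (c₁ c₂ : Fin n)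
    (L₁ L₂ : Finset (Fin n)) : Prop :=
  L₁.Nonempty ∧ L₂.Nonempty ∧ Disjoint L₁ L₂ ∧
  c₁ ∉ L₁ ∪ L₂ ∧ c₂ ∉ L₁ ∪ L₂ ∧ c₁ ≠ c₂ ∧
  S = insert c₁ (insert c₂ (L₁ ∪ L₂)) ∧ pos θ c₁ < pos θ c₂

/-- `S` is a super (left/middle/right) 2-nebula of `T` under `θ`, with centers `c₁, c₂` and
leaves `L₁` (incident to `c₁`) and `L₂` (incident to `c₂`). -/
def IsSuper2NebulaAt (T : Tournament n) (θ : Equiv.Perm (Fin n)) (S : Finset (Fin n))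
    (c₁ c₂ : Fin n) (L₁ L₂ : Finset (Fin n)) : NebKind → Prop
  | NebKind.middle =>
      Super2NebCommon θ S c₁ c₂ L₁ L₂ ∧
      (∀ v ∈ L₁ ∪ L₂, pos θ c₁ < pos θ v ∧ pos θ v < pos θ c₂) ∧
      (∀ v ∈ L₁, T.adj v c₁) ∧ (∀ v ∈ L₂, T.adj c₂ v) ∧ T.adj c₂ c₁ ∧
      (∀ u ∈ S, ∀ v ∈ S, T.Backward θ u v →
        (u ∈ L₁ ∧ v = c₁) ∨ (u = c₂ ∧ v ∈ L₂) ∨ (u = c₂ ∧ v = c₁))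
  | NebKind.left =>
      Super2NebCommon θ S c₁ c₂ L₁ L₂ ∧
      (∀ v ∈ L₁ ∪ L₂, pos θ v < pos θ c₁) ∧
      (∀ v ∈ L₁, T.adj c₁ v) ∧ (∀ v ∈ L₂, T.adj c₂ v) ∧ T.adj c₂ c₁ ∧
      (∀ u ∈ S, ∀ v ∈ S, T.Backward θ u v →
        (u = c₁ ∧ v ∈ L₁) ∨ (u = c₂ ∧ v ∈ L₂) ∨ (u = c₂ ∧ v = c₁))
  | NebKind.right =>
      Super2NebCommon θ S c₁ c₂ L₁ L₂ ∧
      (∀ v ∈ L₁ ∪ L₂, pos θ c₂ < pos θ v) ∧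
      (∀ v ∈ L₁, T.adj v c₁) ∧ (∀ v ∈ L₂, T.adj v c₂) ∧ T.adj c₂ c₁ ∧
      (∀ u ∈ S, ∀ v ∈ S, T.Backward θ u v →
        (u ∈ L₁ ∧ v = c₁) ∨ (u ∈ L₂ ∧ v = c₂) ∨ (u = c₂ ∧ v = c₁))

/-- A decomposition of `T` witnessing that `T` is a super nebula under `θ`, with stars
`Q i` (centers `ctr i`) and super 2-nebulas `Sig i` (centers `c₁ i, c₂ i`, leaves
`L₁ i, L₂ i`, of kind `kd i`). -/
def SuperNebulaDecomp (T : Tournament n) (θ : Equiv.Perm (Fin n)) {m l : ℕ}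
    (Q : Fin m → Finset (Fin n)) (ctr : Fin m → Fin n)
    (Sig : Fin l → Finset (Fin n)) (c₁ c₂ : Fin l → Fin n)
    (L₁ L₂ : Fin l → Finset (Fin n)) (kd : Fin l → NebKind) : Prop :=
  (∀ i, T.IsStarAt θ (Q i) (ctr i)) ∧
  (∀ i, T.IsSuper2NebulaAt θ (Sig i) (c₁ i) (c₂ i) (L₁ i) (L₂ i) (kd i)) ∧
  (∀ i j, i ≠ j → Disjoint (Q i) (Q j)) ∧
  (∀ i j, i ≠ j → Disjoint (Sig i) (Sig j)) ∧
  (∀ i j, Disjoint (Q i) (Sig j)) ∧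
  (∀ u v, T.Backward θ u v → (∃ i, u ∈ Q i ∧ v ∈ Q i) ∨ (∃ i, u ∈ Sig i ∧ v ∈ Sig i)) ∧
  (∀ i j, ¬ BetweenSet θ (L₁ j ∪ L₂ j) (ctr i)) ∧
  (∀ i j, i ≠ j → ¬ BetweenSet θ (L₁ j ∪ L₂ j) (c₁ i) ∧ ¬ BetweenSet θ (L₁ j ∪ L₂ j) (c₂ i))

/-- `T` is a super nebula. -/
def IsSuperNebula (T : Tournament n) : Prop :=
  ∃ (θ : Equiv.Perm (Fin n)) (m l : ℕ) (Q : Fin m → Finset (Fin n)) (ctr : Fin m → Fin n)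
    (Sig : Fin l → Finset (Fin n)) (c₁ c₂ : Fin l → Fin n)
    (L₁ L₂ : Fin l → Finset (Fin n)) (kd : Fin l → NebKind),
    SuperNebulaDecomp T θ Q ctr Sig c₁ c₂ L₁ L₂ kd

/-- `{a, b, c}` (in this position order) is a triangle of `T` under `θ`:
`a` is the left exterior, `b` the center, `c` the right exterior. -/
def IsTriangleAt (T : Tournament n) (θ : Equiv.Perm (Fin n)) (a b c : Fin n) : Prop :=
  pos θ a < pos θ b ∧ pos θ b < pos θ c ∧ T.adj b a ∧ T.adj c a ∧ T.adj c b

/-- A decomposition of `T` under `θ` into triangles `{A i, B i, C i}` (left exterior, center,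
right exterior) and frontier stars `Q j` with centers `ctr j`, where for each triangle `i`,
the vertices in `forb i` are not allowed to lie between leaves of a star. -/
def TriGalaxyDecomp (T : Tournament n) (θ : Equiv.Perm (Fin n)) {l k : ℕ}
    (A B C : Fin l → Fin n) (Q : Fin k → Finset (Fin n)) (ctr : Fin k → Fin n)
    (forb : Fin l → Finset (Fin n)) : Prop :=
  (∀ i, T.IsTriangleAt θ (A i) (B i) (C i)) ∧
  (∀ j, T.IsFrontierStarAt θ (Q j) (ctr j)) ∧
  (∀ i j, i ≠ j →
    Disjoint ({A i, B i, C i} : Finset (Fin n)) ({A j, B j, C j} : Finset (Fin n))) ∧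
  (∀ i j, Disjoint ({A i, B i, C i} : Finset (Fin n)) (Q j)) ∧
  (∀ i j, i ≠ j → Disjoint (Q i) (Q j)) ∧
  (∀ u v, T.Backward θ u v →
    (∃ i, u ∈ ({A i, B i, C i} : Finset (Fin n)) ∧ v ∈ ({A i, B i, C i} : Finset (Fin n))) ∨
    (∃ j, u ∈ Q j ∧ v ∈ Q j)) ∧
  (∀ i j, i ≠ j → ¬ BetweenSet θ ((Q j).erase (ctr j)) (ctr i)) ∧
  (∀ i j, ∀ x ∈ forb i, ¬ BetweenSet θ ((Q j).erase (ctr j)) x)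

/-- `T` is a Δgalaxy: a triangular galaxy with exactly one triangle. -/
def IsDeltaGalaxy (T : Tournament n) : Prop :=
  ∃ (θ : Equiv.Perm (Fin n)) (a b c : Fin n) (k : ℕ)
    (Q : Fin k → Finset (Fin n)) (ctr : Fin k → Fin n),
    TriGalaxyDecomp T θ (fun _ : Fin 1 => a) (fun _ => b) (fun _ => c) Q ctr
      (fun _ => ({a, b, c} : Finset (Fin n)))

/-- `T` is a central triangular galaxy: centers of triangles may lie between leaves of stars. -/
def IsCentralTriangularGalaxy (T : Tournament n) : Prop :=
  ∃ (θ : Equiv.Perm (Fin n)) (l k : ℕ) (A B C : Fin l → Fin n)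
    (Q : Fin k → Finset (Fin n)) (ctr : Fin k → Fin n),
    TriGalaxyDecomp T θ A B C Q ctr (fun i => ({A i, C i} : Finset (Fin n)))

/-- `T` is a left triangular galaxy: left exteriors of triangles may lie between leaves. -/
def IsLeftTriangularGalaxy (T : Tournament n) : Prop :=
  ∃ (θ : Equiv.Perm (Fin n)) (l k : ℕ) (A B C : Fin l → Fin n)
    (Q : Fin k → Finset (Fin n)) (ctr : Fin k → Fin n),
    TriGalaxyDecomp T θ A B C Q ctr (fun i => ({B i, C i} : Finset (Fin n)))

/-- `T` is a right triangular galaxy: right exteriors of triangles may lie between leaves. -/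
def IsRightTriangularGalaxy (T : Tournament n) : Prop :=
  ∃ (θ : Equiv.Perm (Fin n)) (l k : ℕ) (A B C : Fin l → Fin n)
    (Q : Fin k → Finset (Fin n)) (ctr : Fin k → Fin n),
    TriGalaxyDecomp T θ A B C Q ctr (fun i => ({A i, B i} : Finset (Fin n)))

/-- A decomposition of `T` witnessing that `T` is a nebula under `θ` (no condition on the
location of the centers of the stars). -/
def NebulaDecomp (T : Tournament n) (θ : Equiv.Perm (Fin n)) {k : ℕ}
    (Q : Fin k → Finset (Fin n)) (ctr : Fin k → Fin n) : Prop :=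
  (∀ i, T.IsStarAt θ (Q i) (ctr i)) ∧
  (∀ i j, i ≠ j → Disjoint (Q i) (Q j)) ∧
  (∀ u v, T.Backward θ u v → ∃ i, u ∈ Q i ∧ v ∈ Q i)

/-- `T` is a central nebula: a nebula all of whose stars are 3-vertex middle stars. -/
def IsCentralNebula (T : Tournament n) : Prop :=
  ∃ (θ : Equiv.Perm (Fin n)) (k : ℕ) (Q : Fin k → Finset (Fin n)) (ctr : Fin k → Fin n),
    NebulaDecomp T θ Q ctr ∧ ∀ i, T.IsMiddleStarAt θ (Q i) (ctr i) ∧ (Q i).card = 3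

/-- `T` is a super left nebula: a nebula all of whose stars are left stars. -/
def IsSuperLeftNebula (T : Tournament n) : Prop :=
  ∃ (θ : Equiv.Perm (Fin n)) (k : ℕ) (Q : Fin k → Finset (Fin n)) (ctr : Fin k → Fin n),
    NebulaDecomp T θ Q ctr ∧ ∀ i, T.IsLeftStarAt θ (Q i) (ctr i)

/-- `T` is a super right nebula: a nebula all of whose stars are right stars. -/
def IsSuperRightNebula (T : Tournament n) : Prop :=
  ∃ (θ : Equiv.Perm (Fin n)) (k : ℕ) (Q : Fin k → Finset (Fin n)) (ctr : Fin k → Fin n),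
    NebulaDecomp T θ Q ctr ∧ ∀ i, T.IsRightStarAt θ (Q i) (ctr i)

/-- `T` is an LR-Δgalaxy: a super Δgalaxy in which only the two exteriors of the triangle
may lie between leaves of a star. -/
def IsLRDeltaGalaxy (T : Tournament n) : Prop :=
  ∃ (θ : Equiv.Perm (Fin n)) (a b c : Fin n) (k : ℕ)
    (Q : Fin k → Finset (Fin n)) (ctr : Fin k → Fin n),
    TriGalaxyDecomp T θ (fun _ : Fin 1 => a) (fun _ => b) (fun _ => c) Q ctr
      (fun _ => ({b} : Finset (Fin n)))

/-- `T` is a CR-Δgalaxy. -/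
def IsCRDeltaGalaxy (T : Tournament n) : Prop :=
  ∃ (θ : Equiv.Perm (Fin n)) (a b c : Fin n) (k : ℕ)
    (Q : Fin k → Finset (Fin n)) (ctr : Fin k → Fin n),
    TriGalaxyDecomp T θ (fun _ : Fin 1 => a) (fun _ => b) (fun _ => c) Q ctr
      (fun _ => ({a} : Finset (Fin n))) ∧
    (∀ i j, i ≠ j → BetweenSet θ ((Q i).erase (ctr i)) b →
      BetweenSet θ ((Q j).erase (ctr j)) c →
      (∀ x ∈ (Q i).erase (ctr i), ¬ BetweenSet θ ((Q j).erase (ctr j)) x) ∧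
      (∀ x ∈ (Q j).erase (ctr j), ¬ BetweenSet θ ((Q i).erase (ctr i)) x)) ∧
    (∀ i, BetweenSet θ ((Q i).erase (ctr i)) b → ¬ BetweenSet θ ((Q i).erase (ctr i)) c)

/-- `T` is a CL-Δgalaxy. -/
def IsCLDeltaGalaxy (T : Tournament n) : Prop :=
  ∃ (θ : Equiv.Perm (Fin n)) (a b c : Fin n) (k : ℕ)
    (Q : Fin k → Finset (Fin n)) (ctr : Fin k → Fin n),
    TriGalaxyDecomp T θ (fun _ : Fin 1 => a) (fun _ => b) (fun _ => c) Q ctr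
      (fun _ => ({c} : Finset (Fin n))) ∧
    (∀ i j, i ≠ j → BetweenSet θ ((Q i).erase (ctr i)) b →
      BetweenSet θ ((Q j).erase (ctr j)) a →
      (∀ x ∈ (Q i).erase (ctr i), ¬ BetweenSet θ ((Q j).erase (ctr j)) x) ∧
      (∀ x ∈ (Q j).erase (ctr j), ¬ BetweenSet θ ((Q i).erase (ctr i)) x)) ∧
    (∀ i, BetweenSet θ ((Q i).erase (ctr i)) b → ¬ BetweenSet θ ((Q i).erase (ctr i)) a)

/-- A decomposition of `T` under `θ` into one super 2-nebula (of kind `kd`) and frontier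
stars, covering all of `V(T)`, witnessing that `T` is a Σ-galaxy under `θ`. -/
def SigmaGalaxyDecomp (T : Tournament n) (θ : Equiv.Perm (Fin n))
    (S : Finset (Fin n)) (c₁ c₂ : Fin n) (L₁ L₂ : Finset (Fin n)) (kd : NebKind)
    {m : ℕ} (Q : Fin m → Finset (Fin n)) (ctr : Fin m → Fin n) : Prop :=
  T.IsSuper2NebulaAt θ S c₁ c₂ L₁ L₂ kd ∧
  (∀ j, T.IsFrontierStarAt θ (Q j) (ctr j)) ∧
  (∀ i j, i ≠ j → Disjoint (Q i) (Q j)) ∧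
  (∀ j, Disjoint S (Q j)) ∧
  (∀ v, v ∈ S ∨ ∃ j, v ∈ Q j) ∧
  (∀ u v, T.Backward θ u v → (u ∈ S ∧ v ∈ S) ∨ ∃ j, u ∈ Q j ∧ v ∈ Q j) ∧
  (∀ j, ¬ BetweenSet θ (L₁ ∪ L₂) (ctr j)) ∧
  (∀ j, ¬ BetweenSet θ ((Q j).erase (ctr j)) c₁ ∧ ¬ BetweenSet θ ((Q j).erase (ctr j)) c₂) ∧
  (∀ i j, i ≠ j → ¬ BetweenSet θ ((Q j).erase (ctr j)) (ctr i))

def IsMiddleSigmaGalaxy (T : Tournament n) : Prop :=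
  ∃ (θ : Equiv.Perm (Fin n)) (S : Finset (Fin n)) (c₁ c₂ : Fin n) (L₁ L₂ : Finset (Fin n))
    (m : ℕ) (Q : Fin m → Finset (Fin n)) (ctr : Fin m → Fin n),
    SigmaGalaxyDecomp T θ S c₁ c₂ L₁ L₂ NebKind.middle Q ctr

def IsLeftSigmaGalaxy (T : Tournament n) : Prop :=
  ∃ (θ : Equiv.Perm (Fin n)) (S : Finset (Fin n)) (c₁ c₂ : Fin n) (L₁ L₂ : Finset (Fin n))
    (m : ℕ) (Q : Fin m → Finset (Fin n)) (ctr : Fin m → Fin n),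
    SigmaGalaxyDecomp T θ S c₁ c₂ L₁ L₂ NebKind.left Q ctr

def IsRightSigmaGalaxy (T : Tournament n) : Prop :=
  ∃ (θ : Equiv.Perm (Fin n)) (S : Finset (Fin n)) (c₁ c₂ : Fin n) (L₁ L₂ : Finset (Fin n))
    (m : ℕ) (Q : Fin m → Finset (Fin n)) (ctr : Fin m → Fin n),
    SigmaGalaxyDecomp T θ S c₁ c₂ L₁ L₂ NebKind.right Q ctr

/-- The directed density from `X` to `Y`. -/
noncomputable def density (T : Tournament n) (X Y : Finset (Fin n)) : ℝ :=
  (Set.ncard {p : Fin n × Fin n | p.1 ∈ X ∧ p.2 ∈ Y ∧ T.adj p.1 p.2} : ℝ) /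
    ((X.card : ℝ) * (Y.card : ℝ))

/-- `(S i)` is a smooth `(c, lam, w)`-structure of `T`. -/
def IsSmoothStructure (T : Tournament n) (c lam : ℝ) {N : ℕ} (w : Fin N → Bool)
    (S : Fin N → Finset (Fin n)) : Prop :=
  (∀ i j, i ≠ j → Disjoint (S i) (S j)) ∧
  (∀ i, w i = false → c * (n : ℝ) ≤ ((S i).card : ℝ)) ∧
  (∀ i, w i = true → T.IsTransOn (S i) ∧ c * (T.trSize : ℝ) ≤ ((S i).card : ℝ)) ∧
  (∀ i j, i < j →
    (∀ v ∈ S i, 1 - lam ≤ T.density {v} (S j)) ∧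
    (∀ v ∈ S j, 1 - lam ≤ T.density (S i) {v}))

end Tournament

/-- The backward arcs of `K₆` under its canonical ordering. -/
def K6back : List (ℕ × ℕ) := [(3, 0), (5, 2), (5, 0), (4, 1)]

/-- The tournament `K₆`, on `Fin 6` with its canonical ordering. -/
def K6 : Tournament 6 where
  adj u v := (u.val, v.val) ∈ K6back ∨ (u < v ∧ (v.val, u.val) ∉ K6back)
  asymm := by decide
  total := by decide

/-- The pair `{H₁, H₂}` satisfies the Erdős–Hajnal conjecture: there is `ε > 0` such that
every `{H₁, H₂}`-free tournament `T` has a transitive subtournament of size `≥ |T| ^ ε`. -/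
def EHPair {n₁ n₂ : ℕ} (H₁ : Tournament n₁) (H₂ : Tournament n₂) : Prop :=
  ∃ ε : ℝ, 0 < ε ∧ ∀ (n : ℕ) (T : Tournament n),
    ¬ T.Contains H₁ → ¬ T.Contains H₂ → (n : ℝ) ^ ε ≤ (T.trSize : ℝ)

open Tournament

namespace Tournament

section Auxiliary

open scoped Classical

variable {n h : ℕ}

lemma adj_irrefl (T : Tournament n) (u : Fin n) : ¬ T.adj u u := fun hu => T.asymm u u hu hu

lemma adj_of_not_adj (T : Tournament n) {u v : Fin n} (hne : u ≠ v) (huv : ¬ T.adj u v) :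
    T.adj v u := (T.total u v hne).resolve_left huv

lemma contains_of_hom {T : Tournament n} {H : Tournament h} (f : Fin h → Fin n)
    (hf : ∀ u v, H.adj u v → T.adj (f u) (f v)) : T.Contains H := by
  refine ⟨⟨f, fun u v huv => ?_⟩, fun u v => ⟨hf u v, fun hT => ?_⟩⟩
  · by_contra hne
    rcases H.total u v hne with h1 | h1
    · exact T.adj_irrefl _ (huv ▸ hf _ _ h1)
    · exact T.adj_irrefl _ (huv ▸ hf _ _ h1)
  · by_contra hH
    by_cases hne : u = v
    · subst hne
      exact T.adj_irrefl _ hT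
    · exact T.asymm _ _ hT (hf _ _ (H.adj_of_not_adj hne hH))

lemma IsTransOn.mono {T : Tournament n} {s t : Finset (Fin n)} (ht : T.IsTransOn t)
    (hst : s ⊆ t) : T.IsTransOn s :=
  fun u hu v hv w hw => ht u (hst hu) v (hst hv) w (hst hw)

lemma IsTransOn.union {T : Tournament n} {s t : Finset (Fin n)} (hs : T.IsTransOn s)
    (ht : T.IsTransOn t) (hst : ∀ x ∈ s, ∀ y ∈ t, T.adj x y) : T.IsTransOn (s ∪ t) := by
  intro u hu v hv w hw huv hvw
  have := T.asymm
  simp only [mem_union] at hu hv hw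
  rcases hu with hu | hu <;> rcases hw with hw | hw <;> rcases hv with hv | hv
  · exact hs u hu v hv w hw huv hvw
  · exact absurd (hst w hw v hv) (this _ _ hvw)
  · exact hst u hu w hw
  · exact hst u hu w hw
  · exact absurd (hst v hv u hu) (this _ _ huv)
  · exact absurd (hst w hw v hv) (this _ _ hvw)
  · exact absurd (hst v hv u hu) (this _ _ huv)
  · exact ht u hu v hv w hw huv hvw

lemma isTransOn_singleton (T : Tournament n) (v : Fin n) : T.IsTransOn {v} := by
  intro x hx y hy z hz hxy
  simp only [mem_singleton] at hx hy
  subst hx hy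
  exact absurd hxy (T.adj_irrefl _)

/-- A tournament on at least `2 ^ k` vertices has a transitive subtournament on more than `k`
vertices. -/
lemma exists_isTransOn_of_two_pow_le (T : Tournament n) (k : ℕ) (V : Finset (Fin n))
    (hV : 2 ^ k ≤ V.card) : ∃ t ⊆ V, T.IsTransOn t ∧ k + 1 ≤ t.card := by
  induction k generalizing V with
  | zero =>
    obtain ⟨v, hv⟩ : V.Nonempty := card_pos.1 (by simpa using hV)
    exact ⟨{v}, by simpa using hv, T.isTransOn_singleton v, by simp⟩
  | succ k ih =>
    obtain ⟨v, hv⟩ : V.Nonempty := card_pos.1 (lt_of_lt_of_le (by positivity) hV)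
    have hcard := card_filter_add_card_filter_not (s := V.erase v) (fun u => T.adj v u)
    rw [card_erase_of_mem hv] at hcard
    have hpow : 2 ^ (k + 1) = 2 ^ k + 2 ^ k := by ring
    have hk : 0 < 2 ^ k := by positivity
    by_cases hout : 2 ^ k ≤ ((V.erase v).filter (fun u => T.adj v u)).card
    · obtain ⟨t, htV, ht, htc⟩ := ih _ hout
      have hadj : ∀ y ∈ t, T.adj v y := fun y hy => (mem_filter.1 (htV hy)).2
      refine ⟨{v} ∪ t, ?_, (T.isTransOn_singleton v).union ht (by simpa using hadj), ?_⟩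
      · refine union_subset (by simpa using hv) fun y hy => ?_
        exact mem_of_mem_erase (mem_filter.1 (htV hy)).1
      · rw [card_union_of_disjoint]
        · rw [card_singleton]; omega
        · rw [disjoint_singleton_left]
          exact fun hvt => T.adj_irrefl _ (hadj v hvt)
    · obtain ⟨t, htV, ht, htc⟩ :=
        ih ((V.erase v).filter (fun u => ¬ T.adj v u)) (by omega)
      have hadj : ∀ y ∈ t, T.adj y v := fun y hy => by
        have h1 := mem_filter.1 (htV hy)
        exact T.adj_of_not_adj (ne_of_mem_erase h1.1).symm h1.2
      refine ⟨t ∪ {v}, ?_, ht.union (T.isTransOn_singleton v) (by simpa using hadj), ?_⟩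
      · refine union_subset (fun y hy => ?_) (by simpa using hv)
        exact mem_of_mem_erase (mem_filter.1 (htV hy)).1
      · rw [card_union_of_disjoint]
        · rw [card_singleton]; omega
        · rw [disjoint_singleton_right]
          exact fun hvt => T.adj_irrefl _ (hadj v hvt)

lemma IsTransOn.exists_initial {T : Tournament n} {S : Finset (Fin n)} (hS : T.IsTransOn S)
    (k : ℕ) (hk : k ≤ S.card) :
    ∃ I ⊆ S, I.card = k ∧ ∀ x ∈ I, ∀ y ∈ S \ I, T.adj x y := by
  induction k with
  | zero => exact ⟨∅, by simp, by simp, by simp⟩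
  | succ k ih =>
    obtain ⟨I, hIS, hIc, hI⟩ := ih (by omega)
    have hne : (S \ I).Nonempty := by
      rw [← card_pos, card_sdiff_of_subset hIS]; omega
    obtain ⟨v, hv, hmin⟩ := exists_min_image (S \ I)
      (fun v => ((S \ I).filter (fun u => T.adj u v)).card) hne
    have hvS := mem_sdiff.1 hv
    refine ⟨insert v I, insert_subset hvS.1 hIS, by rw [card_insert_of_notMem hvS.2, hIc], ?_⟩
    intro x hx y hy
    simp only [mem_sdiff, mem_insert, not_or] at hy
    rcases mem_insert.1 hx with rfl | hx
    · by_contra hxy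
      have hyx := T.adj_of_not_adj (Ne.symm hy.2.1) hxy
      have hyI : y ∈ S \ I := mem_sdiff.2 ⟨hy.1, hy.2.2⟩
      refine absurd (hmin y hyI) (not_le.2 (card_lt_card ?_))
      refine ⟨fun u hu => ?_, fun hsub => ?_⟩
      · rw [mem_filter] at hu ⊢
        exact ⟨hu.1, hS u (mem_sdiff.1 hu.1).1 y hy.1 x hvS.1 hu.2 hyx⟩
      · exact T.adj_irrefl y (mem_filter.1 (hsub (mem_filter.2 ⟨hyI, hyx⟩))).2
    · exact hI x hx y (mem_sdiff.2 ⟨hy.1, hy.2.2⟩)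

/-- A transitive set can be cut into consecutive pieces of equal size. -/
lemma IsTransOn.exists_pieces {T : Tournament n} (q h : ℕ) {S : Finset (Fin n)}
    (hS : T.IsTransOn S) (hq : h * q ≤ S.card) :
    ∃ P : ℕ → Finset (Fin n), (∀ p < h, P p ⊆ S ∧ (P p).card = q) ∧
      ∀ p p', p < p' → p' < h → ∀ x ∈ P p, ∀ y ∈ P p', T.adj x y := by
  induction h generalizing S with
  | zero => exact ⟨fun _ => ∅, by simp, by simp⟩
  | succ h ih =>
    have hmul : (h + 1) * q = h * q + q := by ring
    obtain ⟨I, hIS, hIc, hI⟩ := hS.exists_initial q (by omega)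
    obtain ⟨P, hP, hPP⟩ := ih (S := S \ I) (hS.mono sdiff_subset)
      (by rw [card_sdiff_of_subset hIS]; omega)
    refine ⟨fun p => Nat.casesOn p I P, ?_, ?_⟩
    · rintro (_ | p) hp
      · exact ⟨hIS, hIc⟩
      · exact ⟨(hP p (by omega)).1.trans sdiff_subset, (hP p (by omega)).2⟩
    · rintro (_ | p) (_ | p') hpp' hp' x hx y hy
      · omega
      · exact hI x hx y ((hP p' (by omega)).1 hy)
      · omega
      · exact hPP p p' (by omega) (by omega) x hx y hy

lemma exists_disjoint_pieces (q h : ℕ) {S : Finset (Fin n)} (hq : h * q ≤ S.card) :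
    ∃ P : ℕ → Finset (Fin n), (∀ p < h, P p ⊆ S ∧ (P p).card = q) ∧
      ∀ p p', p < h → p' < h → p ≠ p' → Disjoint (P p) (P p') := by
  induction h generalizing S with
  | zero => exact ⟨fun _ => ∅, by simp, by simp⟩
  | succ h ih =>
    have hmul : (h + 1) * q = h * q + q := by ring
    obtain ⟨I, hIS, hIc⟩ := exists_subset_card_eq (s := S) (n := q) (by omega)
    obtain ⟨P, hP, hPP⟩ := ih (S := S \ I) (by rw [card_sdiff_of_subset hIS]; omega)
    refine ⟨fun p => Nat.casesOn p I P, ?_, ?_⟩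
    · rintro (_ | p) hp
      · exact ⟨hIS, hIc⟩
      · exact ⟨(hP p (by omega)).1.trans sdiff_subset, (hP p (by omega)).2⟩
    · rintro (_ | p) (_ | p') hp hp' hpp'
      · omega
      · exact disjoint_sdiff.mono_right (hP p' (by omega)).1
      · exact (disjoint_sdiff.mono_right (hP p (by omega)).1).symm
      · exact hPP p p' (by omega) (by omega) (by omega)

/-- The number of vertices of `Y` that are not out-neighbours of `x`. -/
noncomputable def nonOut (T : Tournament n) (x : Fin n) (Y : Finset (Fin n)) : ℕ :=
  (Y.filter (fun y => ¬ T.adj x y)).card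

/-- The number of vertices of `X` that are not in-neighbours of `y`. -/
noncomputable def nonIn (T : Tournament n) (X : Finset (Fin n)) (y : Fin n) : ℕ :=
  (X.filter (fun x => ¬ T.adj x y)).card

lemma sum_nonOut_eq_sum_nonIn (T : Tournament n) (X Y : Finset (Fin n)) :
    ∑ x ∈ X, T.nonOut x Y = ∑ y ∈ Y, T.nonIn X y := by
  simp only [nonOut, nonIn, card_filter]
  exact sum_comm

lemma nonOut_mono (T : Tournament n) (x : Fin n) {Y Y' : Finset (Fin n)} (hY : Y ⊆ Y') :
    T.nonOut x Y ≤ T.nonOut x Y' := card_le_card (filter_subset_filter _ hY)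

lemma nonIn_mono (T : Tournament n) {X X' : Finset (Fin n)} (hX : X ⊆ X') (y : Fin n) :
    T.nonIn X y ≤ T.nonIn X' y := card_le_card (filter_subset_filter _ hX)

lemma mul_card_filter_lt_le {ι : Type*} (s : Finset ι) (f : ι → ℕ) {a k : ℝ} (ha : 0 < a)
    (hs : ((∑ x ∈ s, f x : ℕ) : ℝ) ≤ a * s.card) :
    k * ((s.filter (fun x => k * a < f x)).card : ℝ) ≤ s.card := by
  have h1 : ((s.filter (fun x => k * a < f x)).card : ℝ) * (k * a)
      ≤ ((∑ x ∈ s, f x : ℕ) : ℝ) := by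
    rw [← nsmul_eq_mul]
    push_cast
    refine (card_nsmul_le_sum _ (fun x => (f x : ℝ)) _ fun x hx => ?_).trans
      (sum_le_sum_of_subset_of_nonneg (filter_subset _ _) fun _ _ _ => Nat.cast_nonneg _)
    exact (mem_filter.1 hx).2.le
  have h2 : a * (k * ((s.filter (fun x => k * a < f x)).card : ℝ)) ≤ a * s.card := by
    linarith
  exact le_of_mul_le_mul_left h2 ha

/-- One step of the greedy embedding of `H`: either the candidate sets contain a large pair that
is almost complete, or some vertex of `C i` leaves enough candidates for every other vertex. -/
lemma exists_sparse_pair_or_good (T : Tournament n) (H : Tournament h) {μ c : ℝ}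
    {V : Finset (Fin n)} {C : Fin h → Finset (Fin n)} (i : Fin h)
    (hdisj : ∀ j k, j ≠ k → Disjoint (C j) (C k))
    (hi : h * (c * V.card) < (C i).card) (D : Finset (Fin h)) (hiD : i ∉ D)
    (hD : ∀ k ∈ D, C k ⊆ V ∧ c * V.card ≤ (C k).card) (hiV : C i ⊆ V) :
    (∃ A ⊆ V, ∃ B ⊆ V, Disjoint A B ∧ c * V.card ≤ A.card ∧ c * V.card ≤ B.card ∧
      ((∑ x ∈ A, T.nonOut x B : ℕ) : ℝ) ≤ μ * B.card * A.card) ∨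
    ∃ x ∈ C i, ∀ k ∈ D, μ * (C k).card ≤ ((C k).filter
      (fun y => (H.adj i k → T.adj x y) ∧ (H.adj k i → T.adj y x))).card := by
  by_contra hcon
  push Not at hcon
  obtain ⟨hpair, hgood⟩ := hcon
  set bad : Fin h → Finset (Fin n) := fun k => (C i).filter (fun x => (((C k).filter
      (fun y => (H.adj i k → T.adj x y) ∧ (H.adj k i → T.adj y x))).card : ℝ)
        < μ * (C k).card) with hbad
  have hsmall : ∀ k ∈ D, ((bad k).card : ℝ) ≤ c * V.card := by
    intro k hk
    by_contra! hlt
    have hik : i ≠ k := fun hik => hiD (hik ▸ hk)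
    have hd : Disjoint (bad k) (C k) := (hdisj i k hik).mono_left (filter_subset _ _)
    have hne : ∀ x ∈ bad k, ∀ y ∈ C k, x ≠ y := fun x hx y hy hxy =>
      disjoint_left.1 hd hx (hxy ▸ hy)
    have hbV : bad k ⊆ V := (filter_subset _ _).trans hiV
    rcases H.total i k hik with hadj | hadj
    · have := hpair (C k) (hD k hk).1 (bad k) hbV hd.symm (hD k hk).2 hlt.le
      rw [sum_nonOut_eq_sum_nonIn] at this
      refine absurd this (not_lt.2 ?_)
      push_cast
      have h1 : ∀ x ∈ bad k, (T.nonIn (C k) x : ℝ) ≤ μ * (C k).card := by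
        intro x hx
        refine le_trans ?_ (mem_filter.1 hx).2.le
        refine Nat.cast_le.2 (card_le_card fun y hy => ?_)
        rw [mem_filter] at hy ⊢
        exact ⟨hy.1, fun _ => T.adj_of_not_adj (hne x hx y hy.1).symm hy.2,
          fun hki => absurd hki (H.asymm _ _ hadj)⟩
      calc _ ≤ ∑ x ∈ bad k, μ * (C k).card := sum_le_sum h1
        _ = _ := by rw [sum_const, nsmul_eq_mul]; ring
    · have := hpair (bad k) hbV (C k) (hD k hk).1 hd hlt.le (hD k hk).2
      refine absurd this (not_lt.2 ?_)
      push_cast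
      have h1 : ∀ x ∈ bad k, (T.nonOut x (C k) : ℝ) ≤ μ * (C k).card := by
        intro x hx
        refine le_trans ?_ (mem_filter.1 hx).2.le
        refine Nat.cast_le.2 (card_le_card fun y hy => ?_)
        rw [mem_filter] at hy ⊢
        exact ⟨hy.1, fun hki => absurd hki (H.asymm _ _ hadj),
          fun _ => T.adj_of_not_adj (hne x hx y hy.1) hy.2⟩
      calc _ ≤ ∑ x ∈ bad k, μ * (C k).card := sum_le_sum h1
        _ = _ := by rw [sum_const, nsmul_eq_mul]; ring
  have hcover : C i ⊆ D.biUnion bad := by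
    intro x hx
    obtain ⟨k, hk, hlt⟩ := hgood x hx
    exact mem_biUnion.2 ⟨k, hk, mem_filter.2 ⟨hx, hlt⟩⟩
  by_cases hD0 : D.Nonempty
  · have h1 : ((C i).card : ℝ) ≤ ∑ k ∈ D, (c * V.card) := by
      calc ((C i).card : ℝ) ≤ ((∑ k ∈ D, (bad k).card : ℕ) : ℝ) :=
            Nat.cast_le.2 ((card_le_card hcover).trans card_biUnion_le)
        _ ≤ _ := by push_cast; exact sum_le_sum hsmall
    rw [sum_const, nsmul_eq_mul] at h1
    obtain ⟨k, hk⟩ := hD0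
    have h2 : (0 : ℝ) ≤ c * V.card := (Nat.cast_nonneg _).trans (hsmall k hk)
    have h3 : (D.card : ℝ) ≤ h := by
      exact_mod_cast (card_le_univ D).trans (by simp)
    nlinarith [mul_le_mul_of_nonneg_right h3 h2]
  · rw [not_nonempty_iff_eq_empty] at hD0
    subst hD0
    obtain ⟨x, hx⟩ : (C i).Nonempty := by
      rw [nonempty_iff_ne_empty]
      intro h0
      by_cases hc : (0 : ℝ) ≤ c * V.card
      · rw [h0] at hi
        simp only [card_empty, Nat.cast_zero] at hi
        nlinarith [mul_nonneg (Nat.cast_nonneg (α := ℝ) h) hc]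
      · push Not at hc
        have := hpair ∅ (by simp) ∅ (by simp) (by simp) (by simpa using hc.le)
          (by simpa using hc.le)
        simp at this
    simpa using hcover hx

/-- An `H`-free tournament has two disjoint linear sets that are almost complete to each other. -/
lemma exists_sparse_pair (H : Tournament h) {μ : ℝ} (hμ : 0 < μ) (hμ1 : μ ≤ 1) :
    ∃ c : ℝ, 0 < c ∧ c ≤ 1 ∧ ∀ (n : ℕ) (T : Tournament n) (V : Finset (Fin n)),
      1 / c ≤ V.card → ¬ T.Contains H →
      ∃ A ⊆ V, ∃ B ⊆ V, Disjoint A B ∧ c * V.card ≤ A.card ∧ c * V.card ≤ B.card ∧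
        ((∑ x ∈ A, T.nonOut x B : ℕ) : ℝ) ≤ μ * B.card * A.card := by
  have hμh : 0 < μ ^ h := pow_pos hμ h
  have hμh1 : μ ^ h ≤ 1 := pow_le_one₀ hμ.le hμ1
  set b : ℝ := h + 1 with hb
  have hb1 : 1 ≤ b := by simp [hb]
  set c : ℝ := μ ^ h / (2 * b ^ 2) with hc
  have hc0 : 0 < c := by positivity
  have hcb : c * (2 * b ^ 2) = μ ^ h := by rw [hc]; field_simp
  have hc1 : c * b ≤ 1 := by nlinarith [mul_pos hc0 (by linarith : 0 < b)]
  refine ⟨c, hc0, by nlinarith, fun n T V hV hfree => ?_⟩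
  by_contra hpair
  have hVb : b ≤ V.card := by
    refine le_trans ?_ hV
    rw [le_div_iff₀ hc0]; linarith
  have hVb' : h + 1 ≤ V.card := by
    rw [hb] at hVb
    exact_mod_cast hVb
  obtain ⟨P, hP, hPd⟩ := exists_disjoint_pieces (V.card / (h + 1)) (h + 1)
    (S := V) (Nat.mul_div_le _ _)
  have hq : (V.card : ℝ) ≤ 2 * b * ((V.card / (h + 1) : ℕ) : ℝ) := by
    have h1 := Nat.div_add_mod V.card (h + 1)
    have h2 := Nat.mod_lt V.card (Nat.succ_pos h)
    have h3 : 1 ≤ V.card / (h + 1) := Nat.div_pos hVb' (Nat.succ_pos h)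
    have h4 : V.card ≤ 2 * (h + 1) * (V.card / (h + 1)) := by nlinarith
    rw [hb]; exact_mod_cast h4
  set w : ℝ := V.card / (2 * b) with hw
  have hwV : w * (2 * b) = V.card := by rw [hw]; field_simp
  have hw0 : 0 < w := by have : (0 : ℝ) < V.card := by linarith
                         positivity
  have hcw : c * V.card * b = μ ^ h * w := by rw [← hwV, ← hcb]; ring
  have hlarge : ∀ i ≤ h, c * V.card * b ≤ μ ^ i * w := fun i hi => by
    rw [hcw]
    exact mul_le_mul_of_nonneg_right (pow_le_pow_of_le_one hμ.le hμ1 hi) hw0.le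
  have hcV : 0 < c * V.card := by
    have : (0 : ℝ) < V.card := by linarith
    positivity
  have key : ∀ i ≤ h, ∃ C : Fin h → Finset (Fin n), (∀ j, C j ⊆ V ∧ (C j).Nonempty) ∧
      (∀ j k, j ≠ k → Disjoint (C j) (C k)) ∧
      (∀ k : Fin h, i ≤ k → μ ^ i * w ≤ (C k).card) ∧
      ∀ j k : Fin h, j.val < i → j ≠ k → ∀ x ∈ C j, ∀ y ∈ C k,
        (H.adj j k → T.adj x y) ∧ (H.adj k j → T.adj y x) := by
    intro i
    induction i with
    | zero =>
      intro _
      have hPw : ∀ k : Fin h, w ≤ (P k).card := fun k => by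
        rw [(hP k (by omega)).2]
        have : w * (2 * b) ≤ ((V.card / (h + 1) : ℕ) : ℝ) * (2 * b) := by rw [hwV]; linarith
        exact le_of_mul_le_mul_right this (by positivity)
      refine ⟨fun j => P j, fun j => ⟨(hP j (by omega)).1, card_pos.1 ?_⟩,
        fun j k hjk => hPd j k (by omega) (by omega) (by omega), ?_, ?_⟩
      · exact_mod_cast hw0.trans_le (hPw j)
      · intro k _
        simpa using hPw k
      · intro j k hj
        omega
    | succ i ih =>
      intro hi
      obtain ⟨C, hCV, hCd, hCw, hC⟩ := ih (by omega)
      set v : Fin h := ⟨i, hi⟩ with hv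
      have hCc : ∀ k : Fin h, i ≤ k → c * V.card * b ≤ (C k).card := fun k hk =>
        (hlarge i (by omega)).trans (hCw k hk)
      have hstep := exists_sparse_pair_or_good T H (μ := μ) (c := c) (V := V) v hCd
        (lt_of_lt_of_le (by rw [hb]; linarith) (hCc v le_rfl))
        (univ.filter (fun k => v < k)) (by simp)
        (fun k hk => ⟨(hCV k).1, le_trans (by nlinarith)
          (hCc k (Fin.le_def.1 (mem_filter.1 hk).2.le))⟩) (hCV v).1
      rcases hstep with hstep | ⟨x, hx, hgood⟩
      · exact absurd hstep hpair
      set C' : Fin h → Finset (Fin n) := fun k => if k = v then {x} else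
        if v < k then (C k).filter
          (fun y => (H.adj v k → T.adj x y) ∧ (H.adj k v → T.adj y x)) else C k with hC'
      have hsub : ∀ k, C' k ⊆ C k := by
        intro k
        simp only [hC']
        split_ifs with h1 h2
        · subst h1; simpa using hx
        · exact filter_subset _ _
        · exact subset_rfl
      have hbig : ∀ k : Fin h, v < k → μ ^ (i + 1) * w ≤ (C' k).card := by
        intro k hk
        simp only [hC', if_neg hk.ne', if_pos hk]
        refine le_trans ?_ (hgood k (by simpa using hk))
        rw [pow_succ, mul_comm _ μ, mul_assoc]
        exact mul_le_mul_of_nonneg_left (hCw k hk.le) hμ.le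
      refine ⟨C', fun j => ⟨(hsub j).trans (hCV j).1, ?_⟩,
        fun j k hjk => (hCd j k hjk).mono (hsub j) (hsub k), fun k hk => hbig k hk, ?_⟩
      · by_cases h2 : v < j
        · refine card_pos.1 ?_
          have : (0 : ℝ) < (C' j).card := lt_of_lt_of_le (by positivity) (hbig j h2)
          exact_mod_cast this
        · by_cases h1 : j = v
          · simp only [hC', if_pos h1, singleton_nonempty]
          · simp only [hC', if_neg h1, if_neg h2]
            exact (hCV j).2
      · intro j k hj hjk y hy z hz
        rcases Nat.lt_succ_iff_lt_or_eq.1 hj with hji | hji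
        · exact hC j k hji hjk y (hsub _ hy) z (hsub _ hz)
        · obtain rfl : j = v := Fin.ext hji
          have hyx : y = x := by simpa [hC'] using hy
          subst hyx
          rcases lt_trichotomy v k with hk | hk | hk
          · simp only [hC', if_neg hk.ne', if_pos hk] at hz
            exact (mem_filter.1 hz).2
          · exact absurd hk hjk
          · exact (hC k v hk hjk.symm z (hsub _ hz) y (hsub _ hy)).symm
  obtain ⟨C, hCV, -, -, hC⟩ := key h le_rfl
  choose f hf using fun j => (hCV j).2
  refine hfree (contains_of_hom f fun u v huv => ?_)
  have hne : u ≠ v := fun huv' => H.adj_irrefl _ (huv' ▸ huv)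
  exact (hC u v u.2 hne _ (hf u) _ (hf v)).1 huv

lemma card_le_four_mul_card_diff {A B B₁ B₂ : Finset (Fin n)} (h₁ : 4 * (B₁.card : ℝ) ≤ B.card)
    (h₂ : 4 * (B₂.card : ℝ) ≤ B.card) (hA : B ⊆ A ∪ (B₁ ∪ B₂)) :
    (B.card : ℝ) ≤ 2 * A.card := by
  have : (B.card : ℝ) ≤ A.card + (B₁.card + B₂.card) := by
    exact_mod_cast (card_le_card hA).trans ((card_union_le _ _).trans
      (Nat.add_le_add_left (card_union_le _ _) _))
  linarith

/-- One link of the chain of almost complete sets, together with a transitive subset. -/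
lemma exists_link (T : Tournament n) {A B : Finset (Fin n)} {μ s : ℝ} (hμ : 0 < μ)
    (hB : B.Nonempty)
    (hAB : ((∑ x ∈ A, T.nonOut x B : ℕ) : ℝ) ≤ μ * B.card * A.card)
    (hS : ∀ X ⊆ A, (A.card : ℝ) ≤ 2 * X.card → ∃ S ⊆ X, T.IsTransOn S ∧ s ≤ S.card)
    (hs : 0 < s) :
    ∃ A' ⊆ A, ∃ S ⊆ A', ∃ B' ⊆ B, (A.card : ℝ) ≤ 2 * A'.card ∧ (B.card : ℝ) ≤ 2 * B'.card ∧
      T.IsTransOn S ∧ s ≤ S.card ∧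
      ∀ y ∈ B', (T.nonIn A' y : ℝ) ≤ 8 * μ * A'.card ∧ (T.nonIn S y : ℝ) ≤ 8 * μ * S.card := by
  have hB0 : (0 : ℝ) < B.card := by exact_mod_cast hB.card_pos
  have hmark := mul_card_filter_lt_le (k := 2) A (fun x => T.nonOut x B)
    (mul_pos hμ hB0) hAB
  set A' := A.filter (fun x => (T.nonOut x B : ℝ) ≤ 2 * (μ * B.card)) with hA'
  have hA'2 : (A.card : ℝ) ≤ 2 * A'.card := by
    have := card_filter_add_card_filter_not (s := A)
      (fun x => (T.nonOut x B : ℝ) ≤ 2 * (μ * B.card))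
    simp only [not_le] at this
    rw [← this]
    rw [← this] at hmark
    push_cast at hmark ⊢
    linarith
  obtain ⟨S, hSA', hStr, hSs⟩ := hS A' (filter_subset _ _) hA'2
  have hS0 : (0 : ℝ) < S.card := hs.trans_le hSs
  have hsum : ∀ Z ⊆ A', (((∑ y ∈ B, T.nonIn Z y : ℕ)) : ℝ) ≤ 2 * μ * Z.card * B.card := by
    intro Z hZ
    rw [← sum_nonOut_eq_sum_nonIn]
    push_cast
    calc _ ≤ ∑ x ∈ Z, 2 * (μ * B.card) := sum_le_sum fun x hx => (mem_filter.1 (hZ hx)).2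
      _ = _ := by rw [sum_const, nsmul_eq_mul]; ring
  have hA'0 : (0 : ℝ) < A'.card := hS0.trans_le (Nat.cast_le.2 (card_le_card hSA'))
  have h1 := mul_card_filter_lt_le (k := 4) B (fun y => T.nonIn A' y)
    (by positivity) (hsum A' subset_rfl)
  have h2 := mul_card_filter_lt_le (k := 4) B (fun y => T.nonIn S y)
    (by positivity) (hsum S hSA')
  refine ⟨A', filter_subset _ _, S, hSA', B.filter (fun y =>
    (T.nonIn A' y : ℝ) ≤ 8 * μ * A'.card ∧ (T.nonIn S y : ℝ) ≤ 8 * μ * S.card),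
    filter_subset _ _, hA'2, card_le_four_mul_card_diff h1 h2 fun y hy => ?_, hStr, hSs,
    fun y hy => (mem_filter.1 hy).2⟩
  simp only [mem_union, mem_filter]
  by_cases h3 : (T.nonIn A' y : ℝ) ≤ 8 * μ * A'.card
  · by_cases h4 : (T.nonIn S y : ℝ) ≤ 8 * μ * S.card
    · exact Or.inl ⟨hy, h3, h4⟩
    · exact Or.inr (Or.inr ⟨hy, by push Not at h4; linarith⟩)
  · exact Or.inr (Or.inl ⟨hy, by push Not at h3; linarith⟩)

/-- An `H`-free tournament contains a long chain of linear sets, each containing a large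
transitive set, such that every vertex of a later set sees almost all of the earlier ones. -/
lemma exists_chain (H : Tournament h) {μ : ℝ} (hμ : 0 < μ) (hμ1 : μ ≤ 1) (M : ℕ) :
    ∃ c : ℝ, 0 < c ∧ c ≤ 1 ∧ ∀ (n : ℕ) (T : Tournament n) (W : Finset (Fin n)) (s : ℝ),
      0 < s → 1 / c ≤ W.card → ¬ T.Contains H →
      (∀ X ⊆ W, c * W.card ≤ X.card → ∃ S ⊆ X, T.IsTransOn S ∧ s ≤ S.card) →
      ∃ A S : ℕ → Finset (Fin n),
        (∀ i < M, A i ⊆ W ∧ c * W.card ≤ (A i).card ∧ S i ⊆ A i ∧ T.IsTransOn (S i) ∧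
          s ≤ (S i).card) ∧
        ∀ i j, i < j → j < M → Disjoint (A i) (A j) ∧
          ∀ y ∈ A j, (T.nonIn (A i) y : ℝ) ≤ 8 * μ * (A i).card ∧
            (T.nonIn (S i) y : ℝ) ≤ 8 * μ * (S i).card := by
  induction M with
  | zero =>
    exact ⟨1, one_pos, le_rfl, fun n T W s _ _ _ _ => ⟨fun _ => ∅, fun _ => ∅, by simp, by simp⟩⟩
  | succ M ih =>
    obtain ⟨c₁, hc₁, hc₁1, hpair⟩ := exists_sparse_pair H hμ hμ1
    obtain ⟨c₂, hc₂, hc₂1, hchain⟩ := ih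
    have hcc : c₁ * c₂ / 2 ≤ c₁ / 2 := by nlinarith
    have hcc2 : c₁ * c₂ / 2 ≤ c₂ / 2 := by nlinarith
    refine ⟨c₁ * c₂ / 2, by positivity, by linarith, fun n T W s hs hW hfree hS => ?_⟩
    have hW1 : 1 ≤ c₁ * c₂ / 2 * W.card := by
      rwa [div_le_iff₀' (by positivity)] at hW
    have hW0 : (0 : ℝ) ≤ W.card := Nat.cast_nonneg _
    have hle1 : c₁ * c₂ / 2 * (W.card : ℝ) ≤ c₁ / 2 * W.card :=
      mul_le_mul_of_nonneg_right hcc hW0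
    obtain ⟨A, hAW, B, hBW, hABd, hA, hB, hAB⟩ := hpair n T W
      (by rw [div_le_iff₀' hc₁]; linarith) hfree
    have hBne : B.Nonempty := by
      refine card_pos.1 ?_
      have : (0 : ℝ) < B.card := by linarith
      exact_mod_cast this
    obtain ⟨A', hA'A, S₀, hS₀, B', hB'B, hA'c, hB'c, hS₀t, hS₀s, hlink⟩ :=
      exists_link T hμ hBne hAB
        (fun X hX hXc => hS X (hX.trans hAW) (by linarith)) hs
    have hB'W : c₁ / 2 * W.card ≤ B'.card := by linarith
    have hB'c₂ : c₁ * c₂ / 2 * (W.card : ℝ) ≤ c₂ * B'.card := by nlinarith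
    obtain ⟨A₁, S₁, hAS, hchain⟩ := hchain n T B' s hs
      (by rw [div_le_iff₀' hc₂]; linarith) hfree
      (fun X hX hXc => hS X (hX.trans (hB'B.trans hBW)) (by linarith))
    refine ⟨fun i => Nat.casesOn i A' A₁, fun i => Nat.casesOn i S₀ S₁, ?_, ?_⟩
    · rintro (_ | i) hi
      · exact ⟨hA'A.trans hAW, show _ ≤ (A'.card : ℝ) by linarith, hS₀, hS₀t, hS₀s⟩
      · obtain ⟨h1, h2, h3⟩ := hAS i (by omega)
        exact ⟨h1.trans (hB'B.trans hBW), hB'c₂.trans h2, h3⟩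
    · rintro (_ | i) (_ | j) hij hj
      · omega
      · have hjB := (hAS j (by omega)).1
        exact ⟨hABd.mono hA'A (hjB.trans hB'B), fun y hy => hlink y (hjB hy)⟩
      · omega
      · exact hchain i j (by omega) (by omega)

/-- A family of sets which is almost complete in one direction can be shrunk to one which is
almost complete in both directions. -/
lemma exists_smooth {ι : Type*} (T : Tournament n) (I : Finset ι) (X : ι → Finset (Fin n))
    (R : ι → ι → Prop) {μ : ℝ} (hμ : 0 < μ) (hX : ∀ i ∈ I, (X i).Nonempty)
    (hR : ∀ i ∈ I, ∀ j ∈ I, R i j → ∀ y ∈ X j, (T.nonIn (X i) y : ℝ) ≤ μ * (X i).card) :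
    ∃ Y : ι → Finset (Fin n), (∀ i ∈ I, Y i ⊆ X i ∧ ((X i).card : ℝ) ≤ 2 * (Y i).card) ∧
      ∀ i ∈ I, ∀ j ∈ I, R i j →
        (∀ x ∈ Y i, (T.nonOut x (Y j) : ℝ) ≤ 4 * I.card * μ * (Y j).card) ∧
        ∀ y ∈ Y j, (T.nonIn (Y i) y : ℝ) ≤ 4 * I.card * μ * (Y i).card := by
  rcases I.eq_empty_or_nonempty with rfl | hI
  · exact ⟨X, by simp, by simp⟩
  have hN1 : (1 : ℝ) ≤ I.card := by exact_mod_cast hI.card_pos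
  set N : ℝ := (I.card : ℝ) with hN
  have hX0 : ∀ i ∈ I, (0 : ℝ) < (X i).card := fun i hi => by exact_mod_cast (hX i hi).card_pos
  set bad : ι → ι → Finset (Fin n) := fun i j =>
    (X i).filter (fun x => 2 * N * (μ * (X j).card) < T.nonOut x (X j)) with hbad
  set Y : ι → Finset (Fin n) := fun i => (X i).filter (fun x =>
    ∀ j ∈ I, R i j → (T.nonOut x (X j) : ℝ) ≤ 2 * N * (μ * (X j).card)) with hY
  have hbadc : ∀ i ∈ I, ∀ j ∈ I, R i j → 2 * N * ((bad i j).card : ℝ) ≤ (X i).card := by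
    intro i hi j hj hij
    refine mul_card_filter_lt_le (X i) (fun x => T.nonOut x (X j)) (mul_pos hμ (hX0 j hj)) ?_
    rw [sum_nonOut_eq_sum_nonIn]
    push_cast
    calc _ ≤ ∑ y ∈ X j, μ * ((X i).card : ℝ) := sum_le_sum (hR i hi j hj hij)
      _ = _ := by rw [sum_const, nsmul_eq_mul]; ring
  have hYc : ∀ i ∈ I, ((X i).card : ℝ) ≤ 2 * (Y i).card := by
    intro i hi
    have hcov : X i ⊆ Y i ∪ (I.filter (R i)).biUnion (bad i) := by
      intro x hx
      by_cases hxY : x ∈ Y i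
      · exact mem_union_left _ hxY
      · simp only [hY, mem_filter, not_and, not_forall, not_le] at hxY
        obtain ⟨j, hj, hij, hlt⟩ := hxY hx
        exact mem_union_right _ (mem_biUnion.2 ⟨j, mem_filter.2 ⟨hj, hij⟩,
          mem_filter.2 ⟨hx, hlt⟩⟩)
    have h1 : ((X i).card : ℝ) ≤ (Y i).card + ∑ j ∈ I.filter (R i), ((bad i j).card : ℝ) := by
      exact_mod_cast (card_le_card hcov).trans ((card_union_le _ _).trans
        (Nat.add_le_add_left card_biUnion_le _))
    have h2 : 2 * N * ∑ j ∈ I.filter (R i), ((bad i j).card : ℝ) ≤ N * (X i).card := by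
      rw [mul_sum]
      calc _ ≤ ∑ j ∈ I.filter (R i), ((X i).card : ℝ) :=
            sum_le_sum fun j hj => hbadc i hi j (mem_filter.1 hj).1 (mem_filter.1 hj).2
        _ = (I.filter (R i)).card * ((X i).card : ℝ) := by rw [sum_const, nsmul_eq_mul]
        _ ≤ _ := mul_le_mul_of_nonneg_right (Nat.cast_le.2 (card_filter_le _ _)) (hX0 i hi).le
    have h3 : N * (2 * ∑ j ∈ I.filter (R i), ((bad i j).card : ℝ)) ≤ N * (X i).card := by
      linarith
    have h4 := le_of_mul_le_mul_left h3 (by linarith)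
    linarith
  refine ⟨Y, fun i hi => ⟨filter_subset _ _, hYc i hi⟩, fun i hi j hj hij => ⟨fun x hx => ?_, fun y hy => ?_⟩⟩
  · have h1 : (T.nonOut x (Y j) : ℝ) ≤ T.nonOut x (X j) :=
      Nat.cast_le.2 (T.nonOut_mono x (filter_subset _ _))
    have h2 := (mem_filter.1 hx).2 j hj hij
    have h3 : 2 * N * μ * ((X j).card : ℝ) ≤ 2 * N * μ * (2 * (Y j).card) :=
      mul_le_mul_of_nonneg_left (hYc j hj) (by positivity)
    linarith
  · have h1 : (T.nonIn (Y i) y : ℝ) ≤ T.nonIn (X i) y :=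
      Nat.cast_le.2 (T.nonIn_mono (filter_subset _ _) y)
    have h2 := hR i hi j hj hij y (filter_subset _ _ hy)
    have h3 : μ * ((X i).card : ℝ) ≤ μ * (2 * (Y i).card) :=
      mul_le_mul_of_nonneg_left (hYc i hi) hμ.le
    have h4 : 2 * μ * ((Y i).card : ℝ) ≤ N * (4 * μ * (Y i).card) := by
      have : 0 ≤ μ * ((Y i).card : ℝ) := by positivity
      nlinarith
    linarith

/-- `V` behaves like the vertex set of an `ε`-critical tournament whose largest transitive
subtournament has `τ` vertices, at the scale `c`. -/
structure CriticalAt (T : Tournament n) (V : Finset (Fin n)) (τ : ℕ) (c : ℝ) : Prop where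
  exists_trans : ∀ X ⊆ V, c * V.card ≤ X.card →
    ∃ t ⊆ X, T.IsTransOn t ∧ (1 - c / 2) * τ ≤ t.card
  card_le : ∀ t ⊆ V, T.IsTransOn t → t.card ≤ τ
  le_size : 1 / c ≤ τ
  le_card : 1 / c ≤ V.card

lemma CriticalAt.not_complete {T : Tournament n} {V : Finset (Fin n)} {τ : ℕ} {c : ℝ}
    (hT : T.CriticalAt V τ c) (hc : 0 < c) {X Y : Finset (Fin n)} (hX : X ⊆ V) (hY : Y ⊆ V)
    (hXY : Disjoint X Y) (hXc : c * V.card ≤ X.card) (hYt : T.IsTransOn Y)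
    (hYc : c * τ ≤ Y.card) :
    (∃ x ∈ X, ∃ y ∈ Y, T.adj x y) ∧ ∃ x ∈ X, ∃ y ∈ Y, T.adj y x := by
  obtain ⟨t, htX, ht, htc⟩ := hT.exists_trans X hX hXc
  have hτ : (0 : ℝ) < τ := lt_of_lt_of_le (by positivity) hT.le_size
  have hcτ := mul_pos hc hτ
  have htY : Disjoint t Y := hXY.mono_left htX
  have hne : ∀ x ∈ t, ∀ y ∈ Y, x ≠ y := fun x hx y hy hxy =>
    disjoint_left.1 htY hx (hxy ▸ hy)
  have hlt : τ < (t ∪ Y).card := by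
    rw [card_union_of_disjoint htY]
    have : (τ : ℝ) < t.card + Y.card := by linarith
    exact_mod_cast this
  constructor
  · by_contra! hcon
    refine absurd (hT.card_le (t ∪ Y) (union_subset (htX.trans hX) hY) ?_) (not_le.2 hlt)
    rw [union_comm]
    exact hYt.union ht fun y hy x hx =>
      T.adj_of_not_adj (hne x hx y hy) (hcon x (htX hx) y hy)
  · by_contra! hcon
    refine absurd (hT.card_le (t ∪ Y) (union_subset (htX.trans hX) hY) ?_) (not_le.2 hlt)
    exact ht.union hYt fun x hx y hy =>
      T.adj_of_not_adj (hne x hx y hy).symm (hcon x (htX hx) y hy)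

lemma CriticalAt.exists_adj {T : Tournament n} {V : Finset (Fin n)} {τ : ℕ} {c : ℝ}
    (hT : T.CriticalAt V τ c) (hc : 0 < c) (hc1 : c ≤ 1 / 2) {X Z : Finset (Fin n)}
    (hX : X ⊆ V) (hZ : Z ⊆ V) (hXZ : Disjoint X Z) (hXc : c * V.card ≤ X.card)
    (hZc : c * V.card ≤ Z.card) : ∃ x ∈ X, ∃ z ∈ Z, T.adj z x := by
  obtain ⟨t, htZ, ht, htc⟩ := hT.exists_trans Z hZ hZc
  have hτ : (0 : ℝ) ≤ τ := Nat.cast_nonneg _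
  obtain ⟨x, hx, z, hz, hzx⟩ := (hT.not_complete hc hX (htZ.trans hZ) (hXZ.mono_right htZ) hXc ht
    (by nlinarith)).2
  exact ⟨x, hx, z, htZ hz, hzx⟩

/-- A long sequence of slots `i < M`, each carrying a linear set `X i none` and a sequence of
consecutive transitive pieces `X i (some p)`, `p < h`, with almost all arcs between different slots
oriented from the earlier slot to the later one. -/
structure Scaffold (T : Tournament n) (V : Finset (Fin n)) (τ : ℕ) (c lam : ℝ) (M h : ℕ)
    (X : ℕ → Option ℕ → Finset (Fin n)) : Prop where
  subset : ∀ i < M, ∀ o ∈ insertNone (range h), X i o ⊆ V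
  linear : ∀ i < M, c * V.card ≤ (X i none).card
  trans : ∀ i < M, ∀ p < h, T.IsTransOn (X i (some p)) ∧ c * τ ≤ (X i (some p)).card
  complete : ∀ i < M, ∀ p q, p < q → q < h → ∀ x ∈ X i (some p), ∀ y ∈ X i (some q), T.adj x y
  disjoint : ∀ i j, i < j → j < M → ∀ o ∈ insertNone (range h), ∀ o' ∈ insertNone (range h),
    Disjoint (X i o) (X j o')
  smooth : ∀ i j, i < j → j < M → ∀ o ∈ insertNone (range h), ∀ o' ∈ insertNone (range h),
    (∀ x ∈ X i o, (T.nonOut x (X j o') : ℝ) ≤ lam * (X j o').card) ∧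
    ∀ y ∈ X j o', (T.nonIn (X i o) y : ℝ) ≤ lam * (X i o).card

lemma IsTransOn.exists_large_pieces {T : Tournament n} {S : Finset (Fin n)} (h : ℕ)
    (hS : T.IsTransOn S) (hh : (h : ℝ) + 1 ≤ S.card) :
    ∃ P : ℕ → Finset (Fin n), (∀ p < h, P p ⊆ S ∧ (S.card : ℝ) ≤ 2 * (h + 1) * (P p).card) ∧
      ∀ p q, p < q → q < h → ∀ x ∈ P p, ∀ y ∈ P q, T.adj x y := by
  obtain ⟨P, hP, hPP⟩ := hS.exists_pieces (S.card / (h + 1)) (h + 1) (Nat.mul_div_le _ _)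
  refine ⟨P, fun p hp => ⟨(hP p (by omega)).1, ?_⟩, fun p q hpq hq => hPP p q hpq (by omega)⟩
  rw [(hP p (by omega)).2]
  have h2 : h + 1 ≤ S.card := by exact_mod_cast hh
  have h3 := Nat.div_add_mod S.card (h + 1)
  have h4 := Nat.mod_lt S.card (Nat.succ_pos h)
  have h5 : 1 ≤ S.card / (h + 1) := Nat.div_pos h2 (Nat.succ_pos h)
  have h6 : S.card ≤ 2 * (h + 1) * (S.card / (h + 1)) := by nlinarith
  exact_mod_cast h6

lemma exists_scaffold_of_chain {T : Tournament n} {V : Finset (Fin n)} {τ M h : ℕ} {c μ lam : ℝ}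
    (hc : 0 < c) (hμ : 0 < μ) (hV : (0 : ℝ) < V.card) (hτ : (0 : ℝ) < τ)
    (hlam : 4 * ((M * (h + 1) : ℕ) : ℝ) * μ ≤ lam) {A : ℕ → Finset (Fin n)}
    {P : ℕ → ℕ → Finset (Fin n)}
    (hA : ∀ i < M, A i ⊆ V ∧ 2 * (c * V.card) ≤ (A i).card)
    (hP : ∀ i < M, ∀ p < h, P i p ⊆ A i ∧ T.IsTransOn (P i p) ∧ 2 * (c * τ) ≤ (P i p).card)
    (hPP : ∀ i < M, ∀ p q, p < q → q < h → ∀ x ∈ P i p, ∀ y ∈ P i q, T.adj x y)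
    (hdisj : ∀ i j, i < j → j < M → Disjoint (A i) (A j))
    (hin : ∀ i j, i < j → j < M → ∀ y ∈ A j, (T.nonIn (A i) y : ℝ) ≤ μ * (A i).card ∧
      ∀ p < h, (T.nonIn (P i p) y : ℝ) ≤ μ * (P i p).card) :
    ∃ X, T.Scaffold V τ c lam M h X := by
  obtain ⟨X, hXn, hXs⟩ : ∃ X : ℕ × Option ℕ → Finset (Fin n),
      (∀ i, X (i, none) = A i) ∧ ∀ i p, X (i, some p) = P i p :=
    ⟨fun x => Option.elim x.2 (A x.1) (P x.1), fun _ => rfl, fun _ _ => rfl⟩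
  have hmem : ∀ {i : ℕ} {o : Option ℕ}, i < M → o ∈ insertNone (range h) →
      (i, o) ∈ range M ×ˢ insertNone (range h) :=
    fun hi ho => mem_product.2 ⟨mem_range.2 hi, ho⟩
  have hnone : none ∈ insertNone (range h) := none_mem_insertNone
  have hsome : ∀ {p : ℕ}, some p ∈ insertNone (range h) ↔ p < h :=
    some_mem_insertNone.trans mem_range
  have hXA : ∀ i < M, ∀ o ∈ insertNone (range h), X (i, o) ⊆ A i := by
    rintro i hi (_ | p) ho
    · rw [hXn]
    · rw [hXs]
      exact (hP i hi p (hsome.1 ho)).1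
  obtain ⟨Y, hYX, hY⟩ := exists_smooth T (range M ×ˢ insertNone (range h)) X
    (fun x y => x.1 < y.1) hμ (by
      rintro ⟨i, _ | p⟩ hx
      all_goals
        have hi := mem_range.1 (mem_product.1 hx).1
        have ho := (mem_product.1 hx).2
        rw [← card_pos, ← Nat.cast_pos (α := ℝ)]
      · rw [hXn]
        exact lt_of_lt_of_le (by positivity) (hA i hi).2
      · rw [hXs]
        exact lt_of_lt_of_le (by positivity) (hP i hi p (hsome.1 ho)).2.2) (by
      rintro ⟨i, _ | p⟩ hx ⟨j, o'⟩ hx' hij y hy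
      all_goals
        have hj := mem_range.1 (mem_product.1 hx').1
        have hyA := hXA j hj o' (mem_product.1 hx').2 hy
      · rw [hXn]
        exact (hin i j hij hj y hyA).1
      · rw [hXs]
        exact (hin i j hij hj y hyA).2 p (hsome.1 (mem_product.1 hx).2))
  rw [card_product, card_range, card_insertNone, card_range] at hY
  refine ⟨fun i o => Y (i, o), ?_, ?_, ?_, ?_, ?_, ?_⟩
  · intro i hi o ho
    exact ((hYX _ (hmem hi ho)).1.trans (hXA i hi o ho)).trans (hA i hi).1
  · intro i hi
    have h1 := (hYX _ (hmem hi hnone)).2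
    rw [hXn] at h1
    linarith [(hA i hi).2]
  · intro i hi p hp
    obtain ⟨h0, h1⟩ := hYX _ (hmem hi (hsome.2 hp))
    rw [hXs] at h0 h1
    obtain ⟨-, h2, h3⟩ := hP i hi p hp
    exact ⟨h2.mono h0, by linarith⟩
  · intro i hi p q hpq hq x hx y hy
    have h1 := (hYX _ (hmem hi (hsome.2 (hpq.trans hq)))).1 hx
    have h2 := (hYX _ (hmem hi (hsome.2 hq))).1 hy
    rw [hXs] at h1 h2
    exact hPP i hi p q hpq hq x h1 y h2
  · intro i j hij hj o ho o' ho'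
    exact (hdisj i j hij hj).mono
      ((hYX _ (hmem (hij.trans hj) ho)).1.trans (hXA i (hij.trans hj) o ho))
      ((hYX _ (hmem hj ho')).1.trans (hXA j hj o' ho'))
  · intro i j hij hj o ho o' ho'
    obtain ⟨h1, h2⟩ := hY _ (hmem (hij.trans hj) ho) _ (hmem hj ho') hij
    exact ⟨fun x hx => (h1 x hx).trans (mul_le_mul_of_nonneg_right hlam (Nat.cast_nonneg _)),
      fun y hy => (h2 y hy).trans (mul_le_mul_of_nonneg_right hlam (Nat.cast_nonneg _))⟩

lemma exists_scaffold {h₀ : ℕ} (H : Tournament h₀) {lam : ℝ} (hlam : 0 < lam) (hlam1 : lam ≤ 1)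
    (M h : ℕ) :
    ∃ c' : ℝ, 0 < c' ∧ c' ≤ 1 ∧ ∀ c : ℝ, 0 < c → c ≤ c' →
      ∀ (n : ℕ) (T : Tournament n) (V : Finset (Fin n)) (τ : ℕ), T.CriticalAt V τ c →
        ¬ T.Contains H → ∃ X, T.Scaffold V τ c' lam M h X := by
  have hh : (0 : ℝ) ≤ h := Nat.cast_nonneg _
  obtain ⟨N, hN⟩ : ∃ N : ℝ, N = ((M * (h + 1) : ℕ) : ℝ) := ⟨_, rfl⟩
  have hN0 : 0 ≤ N := hN ▸ Nat.cast_nonneg _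
  obtain ⟨μ, hμdef⟩ : ∃ μ, μ = lam / (64 * (N + 1) * (h + 1)) := ⟨_, rfl⟩
  have hμ : 0 < μ := by rw [hμdef]; positivity
  have hμeq : 64 * (N + 1) * (h + 1) * μ = lam := by rw [hμdef]; field_simp
  have hμN : 4 * N * (16 * (h + 1) * μ) ≤ lam := by
    have : 0 ≤ (h + 1) * μ := by positivity
    rw [← hμeq]; linarith
  have hμ1 : μ ≤ 1 := by
    rw [hμdef, div_le_one (by positivity)]
    nlinarith [mul_nonneg hN0 hh]
  obtain ⟨c₀, hc₀, hc₀1, hchain⟩ := exists_chain H hμ hμ1 M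
  obtain ⟨c', hc'def⟩ : ∃ c' : ℝ, c' = c₀ / (8 * (h + 1)) := ⟨_, rfl⟩
  have hc' : 0 < c' := by rw [hc'def]; positivity
  have hc'eq : c' * (8 * (h + 1)) = c₀ := by rw [hc'def]; field_simp
  have hc'h : 0 ≤ c' * h := by positivity
  refine ⟨c', hc', by linarith, fun c hc hcc' n T V τ hT hfree => ?_⟩
  have hτ1 : 1 ≤ c * τ := by
    have := hT.le_size
    rwa [div_le_iff₀' hc] at this
  have hτ0 : (0 : ℝ) < τ := by
    by_contra! hcon
    nlinarith
  have hV0 : (0 : ℝ) < V.card := lt_of_lt_of_le (by positivity) hT.le_card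
  have hτc' : 1 ≤ c' * τ := hτ1.trans (mul_le_mul_of_nonneg_right hcc' hτ0.le)
  have hcc₀ : c ≤ c₀ := by linarith
  have hc1 : c ≤ 1 := hcc₀.trans hc₀1
  have hτ8 : c' * τ * (8 * (h + 1)) ≤ τ := by
    calc c' * τ * (8 * (h + 1)) = c₀ * τ := by rw [← hc'eq]; ring
      _ ≤ τ := mul_le_of_le_one_left hτ0.le hc₀1
  obtain ⟨A, S, hAS, hlink⟩ := hchain n T V (τ / 2) (by positivity)
    ((one_div_le_one_div_of_le hc hcc₀).trans hT.le_card) hfree (fun X hX hXc => by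
      obtain ⟨t, htX, ht, htc⟩ := hT.exists_trans X hX
        ((mul_le_mul_of_nonneg_right hcc₀ hV0.le).trans hXc)
      exact ⟨t, htX, ht, by nlinarith⟩)
  have hpieces : ∀ i, ∃ P : ℕ → Finset (Fin n), i < M →
      (∀ p < h, P p ⊆ S i ∧ ((S i).card : ℝ) ≤ 2 * (h + 1) * (P p).card) ∧
      ∀ p q, p < q → q < h → ∀ x ∈ P p, ∀ y ∈ P q, T.adj x y := by
    intro i
    by_cases hi : i < M
    · obtain ⟨P, hP⟩ := (hAS i hi).2.2.2.1.exists_large_pieces h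
        (le_trans (by nlinarith) (hAS i hi).2.2.2.2)
      exact ⟨P, fun _ => hP⟩
    · exact ⟨fun _ => ∅, fun hi' => absurd hi' hi⟩
  choose P hP using hpieces
  refine exists_scaffold_of_chain (A := A) (P := P) hc' (by positivity : 0 < 16 * (h + 1) * μ)
    hV0 hτ0 (hN ▸ hμN) ?_ ?_ (fun i hi => (hP i hi).2) (fun i j hij hj => (hlink i j hij hj).1) ?_
  · intro i hi
    refine ⟨(hAS i hi).1, le_trans ?_ (hAS i hi).2.1⟩
    have : 0 ≤ c' * (V.card : ℝ) := by positivity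
    rw [← hc'eq]
    nlinarith [mul_nonneg this hh]
  · intro i hi p hp
    obtain ⟨-, -, hSA, hSt, hSs⟩ := hAS i hi
    obtain ⟨hPS, hPc⟩ := (hP i hi).1 p hp
    refine ⟨hPS.trans hSA, hSt.mono hPS, ?_⟩
    have h5 : (4 * ((h : ℝ) + 1)) * (2 * (c' * τ)) ≤ (4 * (h + 1)) * ((P i p).card : ℝ) := by
      linarith
    exact le_of_mul_le_mul_left h5 (by positivity)
  · intro i j hij hj y hy
    obtain ⟨h1, h2⟩ := (hlink i j hij hj).2 y hy
    refine ⟨h1.trans ?_, fun p hp => ?_⟩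
    · have : 0 ≤ μ * ((A i).card : ℝ) := by positivity
      nlinarith [mul_nonneg hh this]
    · obtain ⟨hPS, hPc⟩ := (hP i (hij.trans hj)).1 p hp
      have h4 : (T.nonIn (P i p) y : ℝ) ≤ T.nonIn (S i) y :=
        Nat.cast_le.2 (T.nonIn_mono hPS y)
      have h5 := mul_le_mul_of_nonneg_left hPc (by positivity : 0 ≤ 8 * μ)
      linarith

lemma exists_large_subset_forall_link {κ : Type*} (L : Finset κ) (Y : κ → Finset (Fin n))
    (r : Fin n → Fin n → Prop) (A : Finset (Fin n)) (s : ℝ)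
    (hA : ∀ ℓ ∈ L, ∀ X ⊆ A, s ≤ X.card → ∃ x ∈ X, ∃ y ∈ Y ℓ, r x y) :
    ∃ Z ⊆ A, (A.card : ℝ) - L.card * s ≤ Z.card ∧ ∀ x ∈ Z, ∀ ℓ ∈ L, ∃ y ∈ Y ℓ, r x y := by
  refine ⟨A.filter fun x => ∀ ℓ ∈ L, ∃ y ∈ Y ℓ, r x y, filter_subset _ _, ?_,
    fun x hx => (mem_filter.1 hx).2⟩
  have hbad : ∀ ℓ ∈ L, ((A.filter fun x => ¬ ∃ y ∈ Y ℓ, r x y).card : ℝ) ≤ s := by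
    intro ℓ hℓ
    by_contra hlt
    obtain ⟨x, hx, hxy⟩ := hA ℓ hℓ _ (filter_subset _ _) (not_le.1 hlt).le
    exact (mem_filter.1 hx).2 hxy
  have hcover : A ⊆ (A.filter fun x => ∀ ℓ ∈ L, ∃ y ∈ Y ℓ, r x y) ∪
      L.biUnion fun ℓ => A.filter fun x => ¬ ∃ y ∈ Y ℓ, r x y := by
    intro x hx
    simp only [mem_union, mem_filter, mem_biUnion, hx, true_and]
    by_cases hx' : ∀ ℓ ∈ L, ∃ y ∈ Y ℓ, r x y
    · exact Or.inl hx'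
    · push Not at hx'
      obtain ⟨ℓ, hℓ, hn⟩ := hx'
      exact Or.inr ⟨ℓ, hℓ, by push Not; exact hn⟩
  have h1 : (A.card : ℝ) ≤ (A.filter fun x => ∀ ℓ ∈ L, ∃ y ∈ Y ℓ, r x y).card +
      (L.biUnion fun ℓ => A.filter fun x => ¬ ∃ y ∈ Y ℓ, r x y).card := by
    exact_mod_cast (card_le_card hcover).trans (card_union_le _ _)
  have h2 : ((L.biUnion fun ℓ => A.filter fun x => ¬ ∃ y ∈ Y ℓ, r x y).card : ℝ) ≤
      ∑ ℓ ∈ L, ((A.filter fun x => ¬ ∃ y ∈ Y ℓ, r x y).card : ℝ) := by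
    exact_mod_cast card_biUnion_le
  have h3 := sum_le_card_nsmul L _ s hbad
  rw [nsmul_eq_mul] at h3
  linarith

/-- Partial embeddings, one component at a time: if arcs of `H` between different components
correspond to almost complete pairs, it is enough to embed every component into arbitrary halves
of its candidate sets. -/
lemma contains_of_components {ι : Type*} {T : Tournament n} (H : Tournament h) (comp : Fin h → ι)
    (X : Fin h → Finset (Fin n)) {lam : ℝ} (hlam : h * lam ≤ 1 / 2)
    (hsm : ∀ u v, comp u ≠ comp v → H.adj u v →
      (∀ x ∈ X u, (T.nonOut x (X v) : ℝ) ≤ lam * (X v).card) ∧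
      ∀ y ∈ X v, (T.nonIn (X u) y : ℝ) ≤ lam * (X u).card)
    (D₀ : Finset ι) (f₀ : Fin h → Fin n) (hf₀ : ∀ u, comp u ∈ D₀ → f₀ u ∈ X u)
    (hadj₀ : ∀ u v, comp u ∈ D₀ → comp v ∈ D₀ → H.adj u v → T.adj (f₀ u) (f₀ v))
    (hemb : ∀ i ∉ D₀, ∀ Y : Fin h → Finset (Fin n),
      (∀ v, comp v = i → Y v ⊆ X v ∧ ((X v).card : ℝ) ≤ 2 * (Y v).card) →
      ∃ f : Fin h → Fin n, (∀ u, comp u = i → f u ∈ Y u) ∧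
        ∀ u v, comp u = i → comp v = i → H.adj u v → T.adj (f u) (f v)) :
    T.Contains H := by
  have main : ∀ D : Finset ι, ∃ f : Fin h → Fin n, (∀ u, comp u ∈ D₀ ∪ D → f u ∈ X u) ∧
      ∀ u v, comp u ∈ D₀ ∪ D → comp v ∈ D₀ ∪ D → H.adj u v → T.adj (f u) (f v) := by
    intro D
    induction D using Finset.induction_on with
    | empty => exact ⟨f₀, by simpa using hf₀, by simpa using hadj₀⟩
    | insert i D _ ih =>
      obtain ⟨f, hf, hadj⟩ := ih
      by_cases hi : i ∈ D₀ ∪ D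
      · rw [union_insert, insert_eq_of_mem hi]
        exact ⟨f, hf, hadj⟩
      set ok : Fin h → Fin h → Fin n → Prop := fun u v y =>
        (H.adj u v → T.adj (f u) y) ∧ (H.adj v u → T.adj y (f u)) with hok
      set Y : Fin h → Finset (Fin n) := fun v =>
        (X v).filter fun y => ∀ u, comp u ∈ D₀ ∪ D → ok u v y with hY
      have hbad : ∀ v, comp v = i → ∀ u, comp u ∈ D₀ ∪ D →
          (((X v).filter fun y => ¬ ok u v y).card : ℝ) ≤ lam * (X v).card := by
        intro v hv u hu
        have hne : comp u ≠ comp v := fun huv => hi (hv ▸ huv ▸ hu)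
        rcases H.total u v (fun huv => hne (congrArg comp huv)) with huv | huv
        · refine le_trans ?_ ((hsm u v hne huv).1 (f u) (hf u hu))
          rw [nonOut]
          refine Nat.cast_le.2 (card_le_card fun y hy => ?_)
          simp only [mem_filter, hok] at hy ⊢
          exact ⟨hy.1, fun hfy => hy.2 ⟨fun _ => hfy, fun hvu => absurd hvu (H.asymm _ _ huv)⟩⟩
        · refine le_trans ?_ ((hsm v u hne.symm huv).2 (f u) (hf u hu))
          rw [nonIn]
          refine Nat.cast_le.2 (card_le_card fun y hy => ?_)
          simp only [mem_filter, hok] at hy ⊢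
          exact ⟨hy.1, fun hfy => hy.2 ⟨fun hvu => absurd hvu (H.asymm _ _ huv), fun _ => hfy⟩⟩
      obtain ⟨g, hg, hgadj⟩ := hemb i (fun hi' => hi (mem_union_left _ hi')) Y (by
        intro v hv
        refine ⟨filter_subset _ _, ?_⟩
        by_cases hlam0 : (X v).card = 0
        · rw [hlam0, Nat.cast_zero]; positivity
        have hcover : X v ⊆ Y v ∪ (univ.filter fun u => comp u ∈ D₀ ∪ D).biUnion fun u =>
            (X v).filter fun y => ¬ ok u v y := by
          intro y hy
          simp only [hY, mem_union, mem_filter, mem_biUnion, hy, true_and, mem_univ]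
          by_contra! hcon
          obtain ⟨⟨u, hu, hnu⟩, hall⟩ := hcon
          exact hnu (hall u hu)
        have h1 : ((X v).card : ℝ) ≤ (Y v).card +
            ((univ.filter fun u => comp u ∈ D₀ ∪ D).biUnion fun u =>
              (X v).filter fun y => ¬ ok u v y).card := by
          exact_mod_cast (card_le_card hcover).trans (card_union_le _ _)
        have h2 : (((univ.filter fun u => comp u ∈ D₀ ∪ D).biUnion fun u =>
            (X v).filter fun y => ¬ ok u v y).card : ℝ) ≤
            ∑ u ∈ univ.filter fun u => comp u ∈ D₀ ∪ D,
              (((X v).filter fun y => ¬ ok u v y).card : ℝ) := by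
          exact_mod_cast card_biUnion_le
        have h3 := sum_le_card_nsmul (univ.filter fun u => comp u ∈ D₀ ∪ D) _ _
          fun u hu => hbad v hv u (mem_filter.1 hu).2
        have h4 : ((univ.filter fun u => comp u ∈ D₀ ∪ D).card : ℝ) ≤ h := by
          exact_mod_cast (card_le_univ _).trans_eq (Fintype.card_fin h)
        have h5 : 0 ≤ ((univ.filter fun u => comp u ∈ D₀ ∪ D).card : ℝ) := Nat.cast_nonneg _
        have h6 : (0 : ℝ) < (X v).card := by exact_mod_cast Nat.pos_of_ne_zero hlam0
        rw [nsmul_eq_mul] at h3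
        have h7 : ((univ.filter fun u => comp u ∈ D₀ ∪ D).card : ℝ) * lam ≤ 1 / 2 := by
          by_cases h0 : 0 ≤ lam
          · exact (mul_le_mul_of_nonneg_right h4 h0).trans hlam
          · nlinarith
        nlinarith)
      refine ⟨fun u => if comp u = i then g u else f u, fun u hu => ?_, fun u v hu hv huv => ?_⟩
      · dsimp only
        split_ifs with hui
        · exact (mem_filter.1 (hg u hui)).1
        · rw [union_insert, mem_insert] at hu
          exact hf u (hu.resolve_left hui)
      · rw [union_insert, mem_insert] at hu hv
        dsimp only
        split_ifs with hui hvi hvi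
        · exact hgadj u v hui hvi huv
        · exact ((mem_filter.1 (hg u hui)).2 v (hv.resolve_left hvi)).2 huv
        · exact ((mem_filter.1 (hg v hvi)).2 u (hu.resolve_left hui)).1 huv
        · exact hadj u v (hu.resolve_left hui) (hv.resolve_left hvi) huv
  obtain ⟨f, -, hadj⟩ := main (univ.image comp)
  exact contains_of_hom f fun u v => hadj u v (by simp) (by simp)

lemma IsFrontierStarAt.exists_embedding {T : Tournament n} {V : Finset (Fin n)} {τ : ℕ} {c : ℝ}
    (hT : T.CriticalAt V τ c) (hc : 0 < c) {H : Tournament h} {θ : Equiv.Perm (Fin h)}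
    {S : Finset (Fin h)} {z : Fin h} (hS : H.IsFrontierStarAt θ S z)
    {Y : Fin h → Finset (Fin n)} (hYV : ∀ v ∈ S, Y v ⊆ V)
    (hYz : (h + 1) * (c * V.card) ≤ (Y z).card)
    (hYt : ∀ v ∈ S.erase z, T.IsTransOn (Y v) ∧ c * τ ≤ (Y v).card)
    (hYd : ∀ v ∈ S.erase z, Disjoint (Y z) (Y v))
    (hord : ∀ u ∈ S.erase z, ∀ v ∈ S.erase z, pos θ u < pos θ v →
      ∀ x ∈ Y z, ∀ y ∈ Y u, ∀ y' ∈ Y v,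
        (pos θ v < pos θ z → T.adj x y → T.adj x y' → T.adj y y') ∧
        (pos θ z < pos θ u → T.adj y x → T.adj y' x → T.adj y y')) :
    ∃ f : Fin h → Fin n, (∀ u ∈ S, f u ∈ Y u) ∧
      ∀ u ∈ S, ∀ v ∈ S, H.adj u v → T.adj (f u) (f v) := by
  have hV : 1 / c ≤ (V.card : ℝ) := hT.le_card
  have hcV : 0 < c * (V.card : ℝ) := mul_pos hc (lt_of_lt_of_le (by positivity) hV)
  have hcard : ((S.erase z).card : ℝ) ≤ h := by
    exact_mod_cast (card_le_univ _).trans_eq (Fintype.card_fin h)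
  have hpos : ∀ Z : Finset (Fin n), ((Y z).card : ℝ) - (S.erase z).card * (c * V.card) ≤ Z.card →
      Z.Nonempty := by
    intro Z hZ
    have : (0 : ℝ) < Z.card := by nlinarith
    exact card_pos.1 (by exact_mod_cast this)
  rcases hS with ⟨hz, -, hleaf, hback⟩ | ⟨hz, -, hleaf, hback⟩
  · obtain ⟨Z, hZ, hZc, hZr⟩ := exists_large_subset_forall_link (S.erase z) Y
      (fun x y => T.adj y x) (Y z) (c * V.card) fun ℓ hℓ X hX hXc =>
        (hT.not_complete hc (hX.trans (hYV z hz)) (hYV ℓ (mem_of_mem_erase hℓ))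
          ((hYd ℓ hℓ).mono_left hX) hXc (hYt ℓ hℓ).1 (hYt ℓ hℓ).2).2
    obtain ⟨x, hx⟩ := hpos Z hZc
    have : Nonempty (Fin n) := ⟨x⟩
    choose! g hgY hgx using hZr x hx
    refine ⟨Function.update g z x, fun u hu => ?_, fun u hu v hv huv => ?_⟩
    · by_cases huz : u = z
      · subst huz; simpa using hZ hx
      · simpa [huz] using hgY u (mem_erase.2 ⟨huz, hu⟩)
    · by_cases huz : u = z
      · subst huz
        have hvu : v ≠ u := fun hvu => H.adj_irrefl u (hvu ▸ huv)
        exact absurd (hleaf v (mem_erase.2 ⟨hvu, hv⟩)).2 (H.asymm _ _ huv)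
      by_cases hvz : v = z
      · subst hvz
        simpa [huz] using hgx u (mem_erase.2 ⟨huz, hu⟩)
      · have hu' := mem_erase.2 ⟨huz, hu⟩
        have hv' := mem_erase.2 ⟨hvz, hv⟩
        have hlt : pos θ u < pos θ v := by
          rcases lt_trichotomy (pos θ u) (pos θ v) with hlt | heq | hgt
          · exact hlt
          · exact absurd huv (θ.symm.injective heq ▸ H.adj_irrefl u)
          · exact absurd (hback u hu v hv ⟨huv, hgt⟩) hvz
        simpa [huz, hvz] using (hord u hu' v hv' hlt x (hZ hx) _ (hgY u hu') _ (hgY v hv')).2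
          (hleaf u hu').1 (hgx u hu') (hgx v hv')
  · obtain ⟨Z, hZ, hZc, hZr⟩ := exists_large_subset_forall_link (S.erase z) Y
      (fun x y => T.adj x y) (Y z) (c * V.card) fun ℓ hℓ X hX hXc =>
        (hT.not_complete hc (hX.trans (hYV z hz)) (hYV ℓ (mem_of_mem_erase hℓ))
          ((hYd ℓ hℓ).mono_left hX) hXc (hYt ℓ hℓ).1 (hYt ℓ hℓ).2).1
    obtain ⟨x, hx⟩ := hpos Z hZc
    have : Nonempty (Fin n) := ⟨x⟩
    choose! g hgY hgx using hZr x hx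
    refine ⟨Function.update g z x, fun u hu => ?_, fun u hu v hv huv => ?_⟩
    · by_cases huz : u = z
      · subst huz; simpa using hZ hx
      · simpa [huz] using hgY u (mem_erase.2 ⟨huz, hu⟩)
    · by_cases hvz : v = z
      · subst hvz
        have hvu : u ≠ v := fun hvu => H.adj_irrefl u (hvu ▸ huv)
        exact absurd (hleaf u (mem_erase.2 ⟨hvu, hu⟩)).2 (H.asymm _ _ huv)
      by_cases huz : u = z
      · subst huz
        simpa [hvz] using hgx v (mem_erase.2 ⟨hvz, hv⟩)
      · have hu' := mem_erase.2 ⟨huz, hu⟩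
        have hv' := mem_erase.2 ⟨hvz, hv⟩
        have hlt : pos θ u < pos θ v := by
          rcases lt_trichotomy (pos θ u) (pos θ v) with hlt | heq | hgt
          · exact hlt
          · exact absurd huv (θ.symm.injective heq ▸ H.adj_irrefl u)
          · exact absurd (hback u hu v hv ⟨huv, hgt⟩) huz
        simpa [huz, hvz] using (hord u hu' v hv' hlt x (hZ hx) _ (hgY u hu') _ (hgY v hv')).1
          (hleaf v hv').1 (hgx u hu') (hgx v hv')

lemma IsSuper2NebulaAt.exists_embedding {T : Tournament n} {V : Finset (Fin n)} {τ : ℕ} {c : ℝ}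
    (hT : T.CriticalAt V τ c) (hc : 0 < c) (hc1 : c ≤ 1 / 2) {H : Tournament h}
    {θ : Equiv.Perm (Fin h)} {S : Finset (Fin h)} {z₁ z₂ : Fin h} {L₁ L₂ : Finset (Fin h)}
    (hS : H.IsSuper2NebulaAt θ S z₁ z₂ L₁ L₂ NebKind.middle)
    {Y : Fin h → Finset (Fin n)} (hYV : ∀ v ∈ S, Y v ⊆ V)
    (hY₁ : (h + 1) * (c * V.card) ≤ (Y z₁).card) (hY₂ : (h + 1) * (c * V.card) ≤ (Y z₂).card)
    (hYt : ∀ v ∈ L₁ ∪ L₂, T.IsTransOn (Y v) ∧ c * τ ≤ (Y v).card)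
    (hY₁₂ : Disjoint (Y z₁) (Y z₂))
    (hYd : ∀ v ∈ L₁ ∪ L₂, Disjoint (Y z₁) (Y v) ∧ Disjoint (Y z₂) (Y v))
    (hord : ∀ u ∈ L₁ ∪ L₂, ∀ v ∈ L₁ ∪ L₂, pos θ u < pos θ v →
      ∀ y ∈ Y u, ∀ y' ∈ Y v, T.adj y y')
    (htri : ∀ v ∈ L₁ ∪ L₂, ∀ x ∈ Y z₁, ∀ y ∈ Y v, ∀ z ∈ Y z₂,
      ¬ (T.adj y x ∧ T.adj z x ∧ T.adj z y)) :
    ∃ f : Fin h → Fin n, (∀ u ∈ S, f u ∈ Y u) ∧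
      ∀ u ∈ S, ∀ v ∈ S, H.adj u v → T.adj (f u) (f v) := by
  obtain ⟨⟨-, -, hL, hz₁, hz₂, hz, hSeq, hzlt⟩, hbet, hL₁, hL₂, hz₂₁, hback⟩ := hS
  have hV : 1 / c ≤ (V.card : ℝ) := hT.le_card
  have hcV : 0 < c * (V.card : ℝ) := mul_pos hc (lt_of_lt_of_le (by positivity) hV)
  have hcard : ∀ L : Finset (Fin h), (L.card : ℝ) ≤ h := fun L => by
    exact_mod_cast (card_le_univ _).trans_eq (Fintype.card_fin h)
  have hz₁S : z₁ ∈ S := by simp [hSeq]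
  have hz₂S : z₂ ∈ S := by simp [hSeq]
  have hLS : ∀ v ∈ L₁ ∪ L₂, v ∈ S := fun v hv => by
    rw [hSeq]; exact mem_insert_of_mem (mem_insert_of_mem hv)
  obtain ⟨Z₁, hZ₁, hZ₁c, hZ₁r⟩ := exists_large_subset_forall_link L₁ Y
    (fun x y => T.adj y x) (Y z₁) (c * V.card) fun ℓ hℓ X hX hXc => by
      have hℓ' : ℓ ∈ L₁ ∪ L₂ := mem_union_left _ hℓ
      exact (hT.not_complete hc (hX.trans (hYV z₁ hz₁S)) (hYV ℓ (hLS ℓ hℓ'))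
        ((hYd ℓ hℓ').1.mono_left hX) hXc (hYt ℓ hℓ').1 (hYt ℓ hℓ').2).2
  obtain ⟨Z₂, hZ₂, hZ₂c, hZ₂r⟩ := exists_large_subset_forall_link L₂ Y
    (fun x y => T.adj x y) (Y z₂) (c * V.card) fun ℓ hℓ X hX hXc => by
      have hℓ' : ℓ ∈ L₁ ∪ L₂ := mem_union_right _ hℓ
      exact (hT.not_complete hc (hX.trans (hYV z₂ hz₂S)) (hYV ℓ (hLS ℓ hℓ'))
        ((hYd ℓ hℓ').2.mono_left hX) hXc (hYt ℓ hℓ').1 (hYt ℓ hℓ').2).1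
  obtain ⟨x, hx, z, hzZ, hzx⟩ := hT.exists_adj hc hc1 (hZ₁.trans (hYV z₁ hz₁S))
    (hZ₂.trans (hYV z₂ hz₂S)) ((hY₁₂.mono_left hZ₁).mono_right hZ₂)
    (by nlinarith [hcard L₁]) (by nlinarith [hcard L₂])
  have : Nonempty (Fin n) := ⟨x⟩
  choose! g₁ hg₁Y hg₁x using hZ₁r x hx
  choose! g₂ hg₂Y hg₂z using hZ₂r z hzZ
  have hx' := hZ₁ hx
  have hz' := hZ₂ hzZ
  set g : Fin h → Fin n := fun v => if v ∈ L₁ then g₁ v else g₂ v with hgdef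
  have hgY : ∀ v ∈ L₁ ∪ L₂, g v ∈ Y v := by
    intro v hv
    by_cases hv1 : v ∈ L₁
    · simpa [hgdef, hv1] using hg₁Y v hv1
    · simpa [hgdef, hv1] using hg₂Y v ((mem_union.1 hv).resolve_left hv1)
  have hg₁ : ∀ v ∈ L₁, T.adj (g v) x := fun v hv => by simpa [hgdef, hv] using hg₁x v hv
  have hg₂ : ∀ v ∈ L₂, T.adj z (g v) := fun v hv => by
    simpa [hgdef, disjoint_right.1 hL hv] using hg₂z v hv
  have hg₁z : ∀ v ∈ L₁, T.adj (g v) z := fun v hv => by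
    have hv' : v ∈ L₁ ∪ L₂ := mem_union_left _ hv
    refine T.adj_of_not_adj (fun hne => disjoint_left.1 (hYd v hv').2 hz' (hne ▸ hgY v hv'))
      fun hcon => htri v hv' x hx' _ (hgY v hv') z hz' ⟨hg₁ v hv, hzx, hcon⟩
  have hg₂x : ∀ v ∈ L₂, T.adj x (g v) := fun v hv => by
    have hv' : v ∈ L₁ ∪ L₂ := mem_union_right _ hv
    refine T.adj_of_not_adj (fun hne => disjoint_left.1 (hYd v hv').1 hx' (hne ▸ hgY v hv'))
      fun hcon => htri v hv' x hx' _ (hgY v hv') z hz' ⟨hcon, hzx, hg₂ v hv⟩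
  have hforw : ∀ u ∈ S, ∀ v ∈ S, H.adj u v → pos θ v < pos θ u →
      (u ∈ L₁ ∧ v = z₁) ∨ (u = z₂ ∧ v ∈ L₂) ∨ (u = z₂ ∧ v = z₁) :=
    fun u hu v hv huv hlt => hback u hu v hv ⟨huv, hlt⟩
  have hne₁ : ∀ v ∈ L₁ ∪ L₂, v ≠ z₁ := fun v hv hvz => hz₁ (hvz ▸ hv)
  have hne₂ : ∀ v ∈ L₁ ∪ L₂, v ≠ z₂ := fun v hv hvz => hz₂ (hvz ▸ hv)
  set f : Fin h → Fin n := Function.update (Function.update g z₂ z) z₁ x with hf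
  have hfz₁ : f z₁ = x := by simp [hf]
  have hfz₂ : f z₂ = z := by simp [hf, hz.symm]
  have hfL : ∀ v ∈ L₁ ∪ L₂, f v = g v := fun v hv => by simp [hf, hne₁ v hv, hne₂ v hv]
  have hcases : ∀ v ∈ S, v = z₁ ∨ v = z₂ ∨ v ∈ L₁ ∪ L₂ := fun v hv => by
    rwa [hSeq, mem_insert, mem_insert] at hv
  refine ⟨f, fun u hu => ?_, fun u hu v hv huv => ?_⟩
  · rcases hcases u hu with rfl | rfl | hu'
    · rwa [hfz₁]
    · rwa [hfz₂]
    · rw [hfL u hu']; exact hgY u hu'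
  · rcases hcases u hu with rfl | rfl | hu' <;> rcases hcases v hv with rfl | rfl | hv'
    · exact absurd huv (H.adj_irrefl _)
    · exact absurd huv (H.asymm _ _ hz₂₁)
    · rw [hfz₁, hfL v hv']
      rcases mem_union.1 hv' with h1 | h2
      · exact absurd huv (H.asymm _ _ (hL₁ v h1))
      · exact hg₂x v h2
    · rwa [hfz₁, hfz₂]
    · exact absurd huv (H.adj_irrefl _)
    · rw [hfz₂, hfL v hv']
      rcases hforw _ hu v hv huv (hbet v hv').2 with h1 | h2 | h3
      · exact absurd h1.2 (hne₁ v hv')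
      · exact hg₂ v h2.2
      · exact absurd h3.2 (hne₁ v hv')
    · rw [hfz₁, hfL u hu']
      rcases hforw u hu _ hv huv (hbet u hu').1 with h1 | h2 | h3
      · exact hg₁ u h1.1
      · exact absurd h2.1 (hne₂ u hu')
      · exact absurd h3.1 (hne₂ u hu')
    · rw [hfz₂, hfL u hu']
      rcases mem_union.1 hu' with h1 | h2
      · exact hg₁z u h1
      · exact absurd huv (H.asymm _ _ (hL₂ u h2))
    · rw [hfL u hu', hfL v hv']
      rcases lt_trichotomy (pos θ u) (pos θ v) with hlt | heq | hgt
      · exact hord u hu' v hv' hlt _ (hgY u hu') _ (hgY v hv')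
      · exact absurd huv (θ.symm.injective heq ▸ H.adj_irrefl u)
      · rcases hforw u hu v hv huv hgt with h1 | h2 | h3
        · exact absurd h1.2 (hne₁ v hv')
        · exact absurd h2.1 (hne₂ u hu')
        · exact absurd h3.1 (hne₂ u hu')

/-- The number of the slot of `v` when every element of `Z` gets a slot of its own and maximal
blocks of other vertices share a slot. -/
noncomputable def slot (θ : Equiv.Perm (Fin h)) (Z : Finset (Fin h)) (v : Fin h) : ℕ :=
  2 * (Z.filter fun u => pos θ u < pos θ v).card + if v ∈ Z then 1 else 0

lemma pos_injective (θ : Equiv.Perm (Fin h)) : Function.Injective (pos θ) := θ.symm.injective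

lemma slot_lt_two_mul (θ : Equiv.Perm (Fin h)) (Z : Finset (Fin h)) (v : Fin h) :
    slot θ Z v < 2 * h := by
  have h1 : (Z.filter fun u => pos θ u < pos θ v) ⊆ univ.erase v := fun u hu =>
    mem_erase.2 ⟨fun huv => lt_irrefl _ (huv ▸ (mem_filter.1 hu).2), mem_univ u⟩
  have h2 := card_le_card h1
  rw [card_erase_of_mem (mem_univ v), card_univ, Fintype.card_fin] at h2
  have h3 := v.pos
  unfold slot
  split_ifs <;> omega

lemma slot_lt_of_mem {θ : Equiv.Perm (Fin h)} {Z : Finset (Fin h)} {u v : Fin h}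
    (huv : pos θ u < pos θ v) (hZ : u ∈ Z ∨ v ∈ Z) : slot θ Z u < slot θ Z v := by
  have hsub : (Z.filter fun w => pos θ w < pos θ u) ⊆ Z.filter fun w => pos θ w < pos θ v :=
    fun w hw => mem_filter.2 ⟨(mem_filter.1 hw).1, (mem_filter.1 hw).2.trans huv⟩
  unfold slot
  by_cases hu : u ∈ Z
  · have := card_lt_card (ssubset_iff_of_subset hsub |>.2
      ⟨u, mem_filter.2 ⟨hu, huv⟩, fun hcon => lt_irrefl _ (mem_filter.1 hcon).2⟩)
    split_ifs <;> omega
  · have := card_le_card hsub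
    simp only [hu, hZ.resolve_left hu, if_true, if_false]
    omega

lemma slot_le_of_pos_lt {θ : Equiv.Perm (Fin h)} {Z : Finset (Fin h)} {u v : Fin h}
    (huv : pos θ u < pos θ v) : slot θ Z u ≤ slot θ Z v := by
  by_cases hZ : u ∈ Z ∨ v ∈ Z
  · exact (slot_lt_of_mem huv hZ).le
  · have hsub : (Z.filter fun w => pos θ w < pos θ u) ⊆ Z.filter fun w => pos θ w < pos θ v :=
      fun w hw => mem_filter.2 ⟨(mem_filter.1 hw).1, (mem_filter.1 hw).2.trans huv⟩
    have := card_le_card hsub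
    rw [not_or] at hZ
    simp only [slot, hZ.1, hZ.2, if_false]
    omega

lemma slot_eq_of_forall {θ : Equiv.Perm (Fin h)} {Z : Finset (Fin h)} {u v : Fin h}
    (huv : pos θ u < pos θ v) (hu : u ∉ Z) (hv : v ∉ Z)
    (hZ : ∀ z ∈ Z, ¬ (pos θ u < pos θ z ∧ pos θ z < pos θ v)) : slot θ Z u = slot θ Z v := by
  have : (Z.filter fun w => pos θ w < pos θ u) = Z.filter fun w => pos θ w < pos θ v := by
    refine filter_congr fun w hw => ⟨fun h1 => h1.trans huv, fun h1 => ?_⟩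
    rcases lt_trichotomy (pos θ w) (pos θ u) with h2 | h2 | h2
    · exact h2
    · exact absurd (pos_injective θ h2 ▸ hw) hu
    · exact absurd ⟨h2, h1⟩ (hZ w hw)
  simp only [slot, hu, hv, if_false, this]

/-- An assignment of pieces of a scaffold to the vertices of a tournament that is increasing with
respect to the ordering `θ`. -/
structure IsPlacement (θ : Equiv.Perm (Fin h)) (M d : ℕ) (idx : Fin h → ℕ)
    (o : Fin h → Option ℕ) : Prop where
  idx_lt : ∀ v, idx v < M
  mem : ∀ v, o v ∈ insertNone (range d)
  lt_or : ∀ u v, pos θ u < pos θ v → idx u < idx v ∨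
    idx u = idx v ∧ ∃ p q, p < q ∧ o u = some p ∧ o v = some q

lemma Scaffold.adj_of_idx_eq {T : Tournament n} {V : Finset (Fin n)} {τ M d : ℕ} {c lam : ℝ}
    {X : ℕ → Option ℕ → Finset (Fin n)} (hX : T.Scaffold V τ c lam M d X)
    {θ : Equiv.Perm (Fin h)} {idx : Fin h → ℕ} {o : Fin h → Option ℕ}
    (hpl : IsPlacement θ M d idx o) {u v : Fin h} (huv : pos θ u < pos θ v)
    (hidx : idx u = idx v) {x y : Fin n} (hx : x ∈ X (idx u) (o u)) (hy : y ∈ X (idx v) (o v)) :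
    T.adj x y := by
  rcases hpl.lt_or u v huv with hlt | ⟨-, p, q, hpq, hu, hv⟩
  · omega
  · have hq := hpl.mem v
    rw [hv, some_mem_insertNone, mem_range] at hq
    rw [hu] at hx
    rw [hv, ← hidx] at hy
    exact hX.complete _ (hpl.idx_lt u) p q hpq hq x hx y hy

lemma Scaffold.contains_of_placement {κ : Type*} {T : Tournament n} {V : Finset (Fin n)}
    {τ M d : ℕ} {c lam : ℝ} {X : ℕ → Option ℕ → Finset (Fin n)}
    (hX : T.Scaffold V τ c lam M d X) (hcV : 0 < c * V.card) (hcτ : 0 < c * τ)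
    (hlam : 0 ≤ lam) {H : Tournament h} (hhlam : h * lam ≤ 1 / 2) {θ : Equiv.Perm (Fin h)}
    {idx : Fin h → ℕ} {o : Fin h → Option ℕ} (hpl : IsPlacement θ M d idx o)
    (P : κ → Finset (Fin h)) (hP : ∀ i j, i ≠ j → Disjoint (P i) (P j))
    (hback : ∀ u v, H.Backward θ u v → ∃ i, u ∈ P i ∧ v ∈ P i)
    (D₀ : Finset κ) (f₀ : Fin h → Fin n)
    (hf₀ : ∀ i ∈ D₀, ∀ u ∈ P i, f₀ u ∈ X (idx u) (o u))
    (hadj₀ : ∀ i ∈ D₀, ∀ j ∈ D₀, ∀ u ∈ P i, ∀ v ∈ P j, H.adj u v → T.adj (f₀ u) (f₀ v))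
    (hemb : ∀ i ∉ D₀, ∀ Y : Fin h → Finset (Fin n),
      (∀ v ∈ P i, Y v ⊆ X (idx v) (o v) ∧ ((X (idx v) (o v)).card : ℝ) ≤ 2 * (Y v).card) →
      ∃ f : Fin h → Fin n, (∀ u ∈ P i, f u ∈ Y u) ∧
        ∀ u ∈ P i, ∀ v ∈ P i, H.adj u v → T.adj (f u) (f v)) :
    T.Contains H := by
  set comp : Fin h → κ ⊕ Fin h := fun v =>
    if hv : ∃ i, v ∈ P i then Sum.inl hv.choose else Sum.inr v with hcomp
  have hinl : ∀ v i, comp v = Sum.inl i ↔ v ∈ P i := by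
    intro v i
    by_cases hv : ∃ i, v ∈ P i
    · simp only [hcomp, dif_pos hv, Sum.inl.injEq]
      refine ⟨fun hi => hi ▸ hv.choose_spec, fun hi => ?_⟩
      by_contra hne
      exact disjoint_left.1 (hP _ _ hne) hv.choose_spec hi
    · simp only [hcomp, dif_neg hv, reduceCtorEq, false_iff]
      exact fun hi => hv ⟨i, hi⟩
  have hinr : ∀ v w, comp v = Sum.inr w → v = w := by
    intro v w
    by_cases hv : ∃ i, v ∈ P i
    · simp only [hcomp, dif_pos hv, reduceCtorEq, false_implies]
    · simp only [hcomp, dif_neg hv, Sum.inr.injEq, imp_self]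
  have hne : ∀ v, 0 < (X (idx v) (o v)).card := by
    intro v
    have hm := hpl.mem v
    rcases hov : o v with - | p
    · exact_mod_cast hcV.trans_le (hX.linear _ (hpl.idx_lt v))
    · rw [hov, some_mem_insertNone, mem_range] at hm
      exact_mod_cast hcτ.trans_le (hX.trans _ (hpl.idx_lt v) p hm).2
  refine contains_of_components H comp (fun v => X (idx v) (o v)) hhlam ?_ (D₀.image Sum.inl) f₀
    ?_ ?_ ?_
  · intro u v huv hadj
    have hlt : pos θ u < pos θ v := by
      rcases lt_trichotomy (pos θ u) (pos θ v) with hlt | heq | hgt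
      · exact hlt
      · exact absurd (pos_injective θ heq ▸ rfl) huv
      · obtain ⟨i, hui, hvi⟩ := hback u v ⟨hadj, hgt⟩
        exact absurd (((hinl u i).2 hui).trans ((hinl v i).2 hvi).symm) huv
    rcases hpl.lt_or u v hlt with h1 | ⟨h1, -⟩
    · exact hX.smooth _ _ h1 (hpl.idx_lt v) _ (hpl.mem u) _ (hpl.mem v)
    · have hall : ∀ x ∈ X (idx u) (o u), ∀ y ∈ X (idx v) (o v), T.adj x y :=
        fun x hx y hy => hX.adj_of_idx_eq hpl hlt h1 hx hy
      constructor
      · intro x hx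
        rw [nonOut, filter_false_of_mem fun y hy => not_not.2 (hall x hx y hy)]
        simp only [card_empty, Nat.cast_zero]
        positivity
      · intro y hy
        rw [nonIn, filter_false_of_mem fun x hx => not_not.2 (hall x hx y hy)]
        simp only [card_empty, Nat.cast_zero]
        positivity
  · intro u hu
    obtain ⟨i, hi, hiu⟩ := mem_image.1 hu
    exact hf₀ i hi u ((hinl u i).1 hiu.symm)
  · intro u v hu hv
    obtain ⟨i, hi, hiu⟩ := mem_image.1 hu
    obtain ⟨j, hj, hjv⟩ := mem_image.1 hv
    exact hadj₀ i hi j hj u ((hinl u i).1 hiu.symm) v ((hinl v j).1 hjv.symm)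
  · rintro (i | w) hi Y hY
    · obtain ⟨f, hf, hfadj⟩ := hemb i (fun hi' => hi (mem_image_of_mem _ hi')) Y
        fun v hv => hY v ((hinl v i).2 hv)
      exact ⟨f, fun u hu => hf u ((hinl u i).1 hu), fun u v hu hv =>
        hfadj u ((hinl u i).1 hu) v ((hinl v i).1 hv)⟩
    · by_cases hw : comp w = Sum.inr w
      · have hYw : (0 : ℝ) < (Y w).card := by
          have h1 := (hY w hw).2
          have h2 : (0 : ℝ) < (X (idx w) (o w)).card := by exact_mod_cast hne w
          linarith
        obtain ⟨y, hy⟩ := card_pos.1 (by exact_mod_cast hYw)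
        refine ⟨fun _ => y, fun u hu => ?_, fun u v hu hv huv => ?_⟩
        · rwa [hinr u w hu]
        · rw [hinr u w hu, hinr v w hv] at huv
          exact absurd huv (H.adj_irrefl w)
      · obtain ⟨y, -⟩ := card_pos.1 (hne w)
        refine ⟨fun _ => y, fun u hu => ?_, fun u v hu hv huv => ?_⟩
        · exact absurd (hinr u w hu ▸ hu) hw
        · exact absurd (hinr u w hu ▸ hu) hw

lemma IsPlacement.idx_ne_of_eq_none {θ : Equiv.Perm (Fin h)} {M d : ℕ} {idx : Fin h → ℕ}
    {o : Fin h → Option ℕ} (hpl : IsPlacement θ M d idx o) {u v : Fin h} (huv : u ≠ v)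
    (hu : o u = none) : idx u ≠ idx v := by
  rcases lt_or_gt_of_ne (fun hp => huv (pos_injective θ hp)) with hlt | hlt
  · rcases hpl.lt_or u v hlt with h1 | ⟨-, p, q, -, h1, -⟩
    · exact h1.ne
    · exact absurd (hu.symm.trans h1) (by simp)
  · rcases hpl.lt_or v u hlt with h1 | ⟨-, p, q, -, -, h1⟩
    · exact h1.ne'
    · exact absurd (hu.symm.trans h1) (by simp)

lemma Scaffold.disjoint_of_idx_ne {T : Tournament n} {V : Finset (Fin n)} {τ M d : ℕ} {c lam : ℝ}
    {X : ℕ → Option ℕ → Finset (Fin n)} (hX : T.Scaffold V τ c lam M d X)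
    {θ : Equiv.Perm (Fin h)} {idx : Fin h → ℕ} {o : Fin h → Option ℕ}
    (hpl : IsPlacement θ M d idx o) {u v : Fin h} (huv : idx u ≠ idx v) :
    Disjoint (X (idx u) (o u)) (X (idx v) (o v)) := by
  rcases lt_or_gt_of_ne huv with hlt | hlt
  · exact hX.disjoint _ _ hlt (hpl.idx_lt v) _ (hpl.mem u) _ (hpl.mem v)
  · exact (hX.disjoint _ _ hlt (hpl.idx_lt u) _ (hpl.mem v) _ (hpl.mem u)).symm

lemma Scaffold.large_of_eq_none {T : Tournament n} {V : Finset (Fin n)} {τ M d : ℕ} {c c' lam : ℝ}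
    {X : ℕ → Option ℕ → Finset (Fin n)} (hX : T.Scaffold V τ c' lam M d X)
    {θ : Equiv.Perm (Fin h)} {idx : Fin h → ℕ} {o : Fin h → Option ℕ}
    (hpl : IsPlacement θ M d idx o) (hcc : 2 * (h + 1) * c ≤ c') {v : Fin h} (hv : o v = none)
    {Y : Finset (Fin n)} (hY : ((X (idx v) (o v)).card : ℝ) ≤ 2 * Y.card) :
    (h + 1) * (c * V.card) ≤ Y.card := by
  have h1 := hX.linear _ (hpl.idx_lt v)
  have h2 := mul_le_mul_of_nonneg_right hcc (Nat.cast_nonneg (α := ℝ) V.card)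
  rw [hv] at hY
  linarith

lemma Scaffold.trans_of_eq_some {T : Tournament n} {V : Finset (Fin n)} {τ M d : ℕ} {c c' lam : ℝ}
    {X : ℕ → Option ℕ → Finset (Fin n)} (hX : T.Scaffold V τ c' lam M d X)
    {θ : Equiv.Perm (Fin h)} {idx : Fin h → ℕ} {o : Fin h → Option ℕ}
    (hpl : IsPlacement θ M d idx o) (hc : 0 < c) (hcc : 2 * (h + 1) * c ≤ c') {v : Fin h} {p : ℕ}
    (hv : o v = some p) {Y : Finset (Fin n)} (hYX : Y ⊆ X (idx v) (o v))
    (hY : ((X (idx v) (o v)).card : ℝ) ≤ 2 * Y.card) : T.IsTransOn Y ∧ c * τ ≤ Y.card := by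
  have hp := hpl.mem v
  rw [hv, some_mem_insertNone, mem_range] at hp
  rw [hv] at hY hYX
  obtain ⟨h1, h2⟩ := hX.trans _ (hpl.idx_lt v) p hp
  refine ⟨h1.mono hYX, ?_⟩
  have h3 : 2 * c ≤ c' := by
    have : 0 ≤ (h : ℝ) * c := by positivity
    linarith
  have h4 := mul_le_mul_of_nonneg_right h3 (Nat.cast_nonneg (α := ℝ) τ)
  linarith

lemma Scaffold.exists_star_embedding {T : Tournament n} {V : Finset (Fin n)} {τ M d : ℕ}
    {c c' lam : ℝ} (hT : T.CriticalAt V τ c) (hc : 0 < c) {X : ℕ → Option ℕ → Finset (Fin n)}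
    (hX : T.Scaffold V τ c' lam M d X) {H : Tournament h} (hcc : 2 * (h + 1) * c ≤ c')
    {θ : Equiv.Perm (Fin h)} {idx : Fin h → ℕ} {o : Fin h → Option ℕ}
    (hpl : IsPlacement θ M d idx o) {S : Finset (Fin h)} {z : Fin h}
    (hS : H.IsFrontierStarAt θ S z) (hz : o z = none) (hleaf : ∀ v ∈ S.erase z, ∃ p, o v = some p)
    (hord : ∀ u ∈ S.erase z, ∀ v ∈ S.erase z, pos θ u < pos θ v → idx u ≠ idx v →
      ∀ x ∈ X (idx z) (o z), ∀ y ∈ X (idx u) (o u), ∀ y' ∈ X (idx v) (o v),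
        (pos θ v < pos θ z → T.adj x y → T.adj x y' → T.adj y y') ∧
        (pos θ z < pos θ u → T.adj y x → T.adj y' x → T.adj y y'))
    {Y : Fin h → Finset (Fin n)}
    (hY : ∀ v ∈ S, Y v ⊆ X (idx v) (o v) ∧ ((X (idx v) (o v)).card : ℝ) ≤ 2 * (Y v).card) :
    ∃ f : Fin h → Fin n, (∀ u ∈ S, f u ∈ Y u) ∧
      ∀ u ∈ S, ∀ v ∈ S, H.adj u v → T.adj (f u) (f v) := by
  have hzS : z ∈ S := by rcases hS with hS | hS <;> exact hS.1
  refine hS.exists_embedding hT hc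
    (fun v hv => (hY v hv).1.trans (hX.subset _ (hpl.idx_lt v) _ (hpl.mem v)))
    (hX.large_of_eq_none hpl hcc hz (hY z hzS).2) ?_ ?_ ?_
  · intro v hv
    obtain ⟨p, hp⟩ := hleaf v hv
    have hv' := hY v (mem_of_mem_erase hv)
    exact hX.trans_of_eq_some hpl hc hcc hp hv'.1 hv'.2
  · intro v hv
    exact ((hX.disjoint_of_idx_ne hpl (hpl.idx_ne_of_eq_none (ne_of_mem_erase hv).symm hz)).mono_left
      (hY z hzS).1).mono_right (hY v (mem_of_mem_erase hv)).1
  · intro u hu v hv huv x hx y hy y' hy'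
    have hx' := (hY z hzS).1 hx
    have hyu := (hY u (mem_of_mem_erase hu)).1 hy
    have hyv := (hY v (mem_of_mem_erase hv)).1 hy'
    by_cases hidx : idx u = idx v
    · have := hX.adj_of_idx_eq hpl huv hidx hyu hyv
      exact ⟨fun _ _ _ => this, fun _ _ _ => this⟩
    · exact hord u hu v hv huv hidx x hx' y hyu y' hyv

lemma IsFrontierStarAt.not_betweenSet_center {H : Tournament h} {θ : Equiv.Perm (Fin h)}
    {S : Finset (Fin h)} {z : Fin h} (hS : H.IsFrontierStarAt θ S z) :
    ¬ BetweenSet θ (S.erase z) z := by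
  rintro ⟨u, hu, w, hw, huz, hzw⟩
  rcases hS with ⟨-, -, hl, -⟩ | ⟨-, -, hl, -⟩
  · exact absurd (hl u hu).1 (not_lt.2 huz.le)
  · exact absurd (hl w hw).1 (not_lt.2 hzw.le)

lemma IsFrontierStarAt.center_mem {H : Tournament h} {θ : Equiv.Perm (Fin h)}
    {S : Finset (Fin h)} {z : Fin h} (hS : H.IsFrontierStarAt θ S z) : z ∈ S := by
  rcases hS with hS | hS <;> exact hS.1

/-- The slots used to embed a central triangular galaxy with triangle `a, b, c` when the triangle
is already embedded in the slots `i`, `j`, `k`. -/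
noncomputable def triIdx (θ : Equiv.Perm (Fin h)) (Z : Finset (Fin h)) (a b c : Fin h)
    (i j k : ℕ) (v : Fin h) : ℕ :=
  if pos θ v ≤ pos θ a then i + slot θ Z v - slot θ Z a
  else if pos θ v < pos θ c then j + slot θ Z v - slot θ Z b
  else k + slot θ Z v - slot θ Z c

/-- The pieces of slots used to embed a central triangular galaxy with triangle `a, b, c` when the
triangle is already embedded in the pieces `oa`, `some p`, `oc`. -/
noncomputable def triPiece (θ : Equiv.Perm (Fin h)) (Z : Finset (Fin h)) (a b c : Fin h)
    (q p : ℕ) (oa oc : Option ℕ) (v : Fin h) : Option ℕ :=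
  if v = a then oa else if v = c then oc else if v = b then some p else if v ∈ Z then none
  else if pos θ v < pos θ b then some (pos θ v) else some (h + q + pos θ v)

lemma isPlacement_tri {θ : Equiv.Perm (Fin h)} {Z : Finset (Fin h)} {a b c : Fin h}
    (haZ : a ∈ Z) (hcZ : c ∈ Z) (hbZ : b ∉ Z) (hab : pos θ a < pos θ b) (hbc : pos θ b < pos θ c)
    {M q i j k p : ℕ} {oa oc : Option ℕ} (hi : 2 * h ≤ i) (hij : i + 2 * h < j)
    (hjk : j + 2 * h < k) (hkM : k + 2 * h < M) (hoa : oa ∈ insertNone (range (2 * h + q)))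
    (hoc : oc ∈ insertNone (range (2 * h + q))) (hp : h ≤ p) (hpq : p < h + q) :
    IsPlacement θ M (2 * h + q) (triIdx θ Z a b c i j k) (triPiece θ Z a b c q p oa oc) where
  idx_lt v := by
    have h1 := slot_lt_two_mul θ Z v
    unfold triIdx
    split_ifs <;> omega
  mem v := by
    have h1 := (pos θ v).isLt
    unfold triPiece
    split_ifs
    · exact hoa
    · exact hoc
    · simp only [some_mem_insertNone, mem_range]; omega
    · exact none_mem_insertNone
    · simp only [some_mem_insertNone, mem_range]; omega
    · simp only [some_mem_insertNone, mem_range]; omega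
  lt_or u v huv := by
    have hua := slot_lt_two_mul θ Z a
    have hub := slot_lt_two_mul θ Z b
    have hu := slot_lt_two_mul θ Z u
    have hv := slot_lt_two_mul θ Z v
    have hcv : pos θ c ≤ pos θ v → slot θ Z c ≤ slot θ Z v := fun hle => by
      rcases hle.lt_or_eq with hlt | heq
      · exact slot_le_of_pos_lt hlt
      · rw [pos_injective θ heq]
    have hau : pos θ u ≤ pos θ a → slot θ Z u ≤ slot θ Z a := fun hle => by
      rcases hle.lt_or_eq with hlt | heq
      · exact slot_le_of_pos_lt hlt
      · rw [pos_injective θ heq]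
    have hcu : pos θ c ≤ pos θ u → slot θ Z c ≤ slot θ Z u := fun hle => by
      rcases hle.lt_or_eq with hlt | heq
      · exact slot_le_of_pos_lt hlt
      · rw [pos_injective θ heq]
    have hle : slot θ Z u ≤ slot θ Z v := slot_le_of_pos_lt huv
    by_cases hlt : slot θ Z u < slot θ Z v
    · left
      unfold triIdx
      split_ifs <;> omega
    have heq : slot θ Z u = slot θ Z v := le_antisymm hle (not_lt.1 hlt)
    have huZ : u ∉ Z := fun huZ => hlt (slot_lt_of_mem huv (Or.inl huZ))
    have hvZ : v ∉ Z := fun hvZ => hlt (slot_lt_of_mem huv (Or.inr hvZ))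
    have hua : u ≠ a := fun hne => huZ (hne ▸ haZ)
    have hva : v ≠ a := fun hne => hvZ (hne ▸ haZ)
    have huc : u ≠ c := fun hne => huZ (hne ▸ hcZ)
    have hvc : v ≠ c := fun hne => hvZ (hne ▸ hcZ)
    by_cases hidx : triIdx θ Z a b c i j k u < triIdx θ Z a b c i j k v
    · exact Or.inl hidx
    right
    refine ⟨?_, ?_⟩
    · unfold triIdx at hidx ⊢
      split_ifs at hidx ⊢ <;> omega
    · have hpu := (pos θ u).isLt
      have hpv := (pos θ v).isLt
      simp only [triPiece, hua, hva, huc, hvc, huZ, hvZ, if_false]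
      by_cases hub : u = b
      · subst hub
        have hne : v ≠ u := fun hne => absurd huv (hne ▸ lt_irrefl _)
        rw [if_pos rfl, if_neg hne, if_neg huv.le.not_gt]
        exact ⟨_, _, by omega, rfl, rfl⟩
      · rw [if_neg hub]
        by_cases hvb : v = b
        · subst hvb
          rw [if_pos huv, if_pos rfl]
          exact ⟨_, _, by omega, rfl, rfl⟩
        · rw [if_neg hvb]
          split_ifs
          · exact ⟨_, _, huv, rfl, rfl⟩
          · exact ⟨_, _, by omega, rfl, rfl⟩
          · omega
          · exact ⟨_, _, by omega, rfl, rfl⟩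

/-- If `G` is a central triangular galaxy with exactly one triangle, then in a `G`-free tournament
there is no backward triangle spread over distant slots of a scaffold. -/
lemma Scaffold.no_triangle {T : Tournament n} {V : Finset (Fin n)} {τ M q : ℕ}
    {c c' lam : ℝ} (hT : T.CriticalAt V τ c) (hc : 0 < c) {X : ℕ → Option ℕ → Finset (Fin n)}
    (hX : T.Scaffold V τ c' lam M (2 * h + q) X) (hlam : 0 ≤ lam) (hhlam : h * lam ≤ 1 / 2)
    (hcc : 2 * (h + 1) * c ≤ c') {G : Tournament h} {α : Equiv.Perm (Fin h)} {a b e : Fin h}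
    {s : ℕ} {Q : Fin s → Finset (Fin h)} {ctr : Fin s → Fin h}
    (hG : TriGalaxyDecomp G α (fun _ : Fin 1 => a) (fun _ => b) (fun _ => e) Q ctr
      (fun _ => ({a, e} : Finset (Fin h)))) (hfree : ¬ T.Contains G)
    {i j k p : ℕ} {oa oc : Option ℕ} (hi : 2 * h ≤ i) (hij : i + 2 * h < j)
    (hjk : j + 2 * h < k) (hkM : k + 2 * h < M) (hoa : oa ∈ insertNone (range (2 * h + q)))
    (hoc : oc ∈ insertNone (range (2 * h + q))) (hp : h ≤ p) (hpq : p < h + q)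
    {x y z : Fin n} (hx : x ∈ X i oa) (hy : y ∈ X j (some p)) (hz : z ∈ X k oc) :
    ¬ (T.adj y x ∧ T.adj z x ∧ T.adj z y) := by
  rintro ⟨hyx, hzx, hzy⟩
  apply hfree
  obtain ⟨htri, hstar, -, hdis, hQ, hback, hbet, hforb⟩ := hG
  obtain ⟨hab, hbe, hba, hea, heb⟩ := htri 0
  replace hdis := hdis 0
  have hae := hab.trans hbe
  have hab' : a ≠ b := fun hne => absurd hab (hne ▸ lt_irrefl _)
  have hbe' : b ≠ e := fun hne => absurd hbe (hne ▸ lt_irrefl _)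
  have hae' : a ≠ e := fun hne => absurd hae (hne ▸ lt_irrefl _)
  set Z : Finset (Fin h) := insert a (insert e (univ.image ctr)) with hZdef
  have hctrZ : ∀ t, ctr t ∈ Z := fun t => by simp [hZdef]
  have haZ : a ∈ Z := by simp [hZdef]
  have heZ : e ∈ Z := by simp [hZdef]
  have hnot : ∀ t, ∀ v ∈ Q t, v ≠ a ∧ v ≠ b ∧ v ≠ e := by
    intro t v hv
    have := disjoint_right.1 (hdis t) hv
    simpa only [mem_insert, mem_singleton, not_or] using this
  have hZ : ∀ v ∈ Z, v = a ∨ v = e ∨ ∃ t, ctr t = v := by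
    intro v hv
    simpa [hZdef] using hv
  have hbZ : b ∉ Z := by
    intro hb
    rcases hZ b hb with h1 | h1 | ⟨t, ht⟩
    · exact hab' h1.symm
    · exact hbe' h1
    · exact (hnot t b (ht ▸ (hstar t).center_mem)).2.1 rfl
  have hleafZ : ∀ t, ∀ v ∈ (Q t).erase (ctr t), v ∉ Z := by
    intro t v hv hvZ
    have hvQ := mem_of_mem_erase hv
    rcases hZ v hvZ with h1 | h1 | ⟨t', ht'⟩
    · exact (hnot t v hvQ).1 h1
    · exact (hnot t v hvQ).2.2 h1
    · by_cases htt : t' = t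
      · exact ne_of_mem_erase hv (htt ▸ ht'.symm)
      · exact disjoint_left.1 (hQ t' t htt) (hstar t').center_mem (ht' ▸ hvQ)
  have hpl := isPlacement_tri (q := q) (p := p) haZ heZ hbZ hab hbe hi hij hjk hkM hoa hoc hp hpq
  set idx := triIdx α Z a b e i j k with hidx
  set o := triPiece α Z a b e q p oa oc with ho
  have hia : idx a = i := by simp [hidx, triIdx]
  have hib : idx b = j := by simp [hidx, triIdx, hab.not_ge, hbe]
  have hie : idx e = k := by simp [hidx, triIdx, hae.not_ge]
  have hoa' : o a = oa := by simp [ho, triPiece]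
  have hob' : o b = some p := by simp [ho, triPiece, hab'.symm, hbe']
  have hoe' : o e = oc := by simp [ho, triPiece, hae'.symm]
  have hV : 0 < c * (V.card : ℝ) := mul_pos hc (lt_of_lt_of_le (by positivity) hT.le_card)
  have hτ : 0 < c * (τ : ℝ) := mul_pos hc (lt_of_lt_of_le (by positivity) hT.le_size)
  have hc' : 0 < c' := lt_of_lt_of_le (by positivity) hcc
  have hV' : 0 < c' * (V.card : ℝ) := mul_pos hc' (pos_of_mul_pos_right hV hc.le)
  have hτ' : 0 < c' * (τ : ℝ) := mul_pos hc' (pos_of_mul_pos_right hτ hc.le)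
  set P : Option (Fin s) → Finset (Fin h) := fun t => t.elim {a, b, e} Q with hP
  refine hX.contains_of_placement hV' hτ' hlam hhlam hpl P ?_ ?_ {none}
    (fun v => if v = a then x else if v = b then y else z) ?_ ?_ ?_
  · rintro (- | t) (- | t') hne
    · exact absurd rfl hne
    · exact hdis t'
    · exact (hdis t).symm
    · exact hQ t t' fun htt => hne (congrArg some htt)
  · intro u v huv
    rcases hback u v huv with ⟨_, h1⟩ | ⟨t, h1⟩
    · exact ⟨none, h1⟩
    · exact ⟨some t, h1⟩
  · intro t ht u hu
    rw [mem_singleton] at ht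
    subst ht
    simp only [hP, Option.elim_none, mem_insert, mem_singleton] at hu
    rcases hu with rfl | rfl | rfl
    · simpa [hia, hoa'] using hx
    · simpa [hib, hob', hab'.symm] using hy
    · simpa [hie, hoe', hae'.symm, hbe'.symm] using hz
  · intro t ht t' ht' u hu v hv huv
    rw [mem_singleton] at ht ht'
    subst ht ht'
    simp only [hP, Option.elim_none, mem_insert, mem_singleton] at hu hv
    rcases hu with rfl | rfl | rfl <;> rcases hv with rfl | rfl | rfl
    · exact absurd huv (G.adj_irrefl _)
    · exact absurd huv (G.asymm _ _ hba)
    · exact absurd huv (G.asymm _ _ hea)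
    · simpa [hab'.symm] using hyx
    · exact absurd huv (G.adj_irrefl _)
    · exact absurd huv (G.asymm _ _ heb)
    · simpa [hae'.symm, hbe'.symm] using hzx
    · simpa [hae'.symm, hbe'.symm, hab'.symm] using hzy
    · exact absurd huv (G.adj_irrefl _)
  · rintro (- | t) ht Y hY
    · exact absurd (mem_singleton_self _) ht
    refine hX.exists_star_embedding hT hc hcc hpl (hstar t) ?_ ?_ ?_ hY
    · have h1 := hnot t _ (hstar t).center_mem
      simp [ho, triPiece, h1.1, h1.2.1, h1.2.2, hctrZ]
    · intro v hv
      have h1 := hnot t v (mem_of_mem_erase hv)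
      simp only [ho, triPiece, h1.1, h1.2.1, h1.2.2, hleafZ t v hv, if_false]
      split_ifs <;> exact ⟨_, rfl⟩
    · intro u hu v hv huv hne
      refine absurd ?_ hne
      have hbetZ : ∀ w ∈ Z, ¬ (pos α u < pos α w ∧ pos α w < pos α v) := by
        rintro w hw ⟨huw, hwv⟩
        have hB : BetweenSet α ((Q t).erase (ctr t)) w := ⟨u, hu, v, hv, huw, hwv⟩
        rcases hZ w hw with rfl | rfl | ⟨t', rfl⟩
        · exact hforb 0 t w (by simp) hB
        · exact hforb 0 t w (by simp) hB
        · by_cases htt : t' = t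
          · subst htt
            exact (hstar t').not_betweenSet_center hB
          · exact hbet t' t htt hB
      have hslot := slot_eq_of_forall huv (hleafZ t u hu) (hleafZ t v hv) hbetZ
      have hua : pos α u ≠ pos α a := fun heq =>
        hleafZ t u hu (pos_injective α heq ▸ haZ)
      have hve : pos α v ≠ pos α e := fun heq =>
        hleafZ t v hv (pos_injective α heq ▸ heZ)
      have h1 := hbetZ a haZ
      have h2 := hbetZ e heZ
      have h3 : pos α u ≤ pos α a ↔ pos α v ≤ pos α a := by
        refine ⟨fun hle => ?_, fun hle => huv.le.trans hle⟩
        by_contra hcon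
        exact h1 ⟨lt_of_le_of_ne hle hua, not_le.1 hcon⟩
      have h4 : pos α u < pos α e ↔ pos α v < pos α e := by
        refine ⟨fun hlt => ?_, fun hlt => huv.trans hlt⟩
        by_contra hcon
        exact h2 ⟨hlt, lt_of_le_of_ne (not_lt.1 hcon) hve.symm⟩
      simp only [hidx, triIdx, h3, h4, hslot]

lemma isPlacement_slot (θ : Equiv.Perm (Fin h)) (Z : Finset (Fin h)) {M g D : ℕ}
    (hD : 0 < D) (hM : D * (2 * h + 1) < M) :
    IsPlacement θ M (2 * g + h) (fun v => D * (slot θ Z v + 1))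
      (fun v => if v ∈ Z then none else some (g + pos θ v)) where
  idx_lt v := by
    have h1 := slot_lt_two_mul θ Z v
    exact (Nat.mul_le_mul_left D (by omega)).trans_lt hM
  mem v := by
    have h1 := (pos θ v).isLt
    split_ifs
    · exact none_mem_insertNone
    · simp only [some_mem_insertNone, mem_range]; omega
  lt_or u v huv := by
    by_cases hlt : slot θ Z u < slot θ Z v
    · exact Or.inl (Nat.mul_lt_mul_of_pos_left (by omega) hD)
    have heq : slot θ Z u = slot θ Z v := le_antisymm (slot_le_of_pos_lt huv) (not_lt.1 hlt)
    have huZ : u ∉ Z := fun huZ => hlt (slot_lt_of_mem huv (Or.inl huZ))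
    have hvZ : v ∉ Z := fun hvZ => hlt (slot_lt_of_mem huv (Or.inr hvZ))
    refine Or.inr ⟨by simp only [heq], g + pos θ u, g + pos θ v, ?_, by simp [huZ], by simp [hvZ]⟩
    have : (pos θ u : ℕ) < pos θ v := huv
    omega

lemma Scaffold.contains_superNebula {T : Tournament n} {V : Finset (Fin n)} {τ M g : ℕ}
    {c c' lam : ℝ} (hT : T.CriticalAt V τ c) (hc : 0 < c) (hc1 : c ≤ 1 / 2)
    {X : ℕ → Option ℕ → Finset (Fin n)} (hX : T.Scaffold V τ c' lam M (2 * g + h) X)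
    (hlam : 0 ≤ lam) (hhlam : h * lam ≤ 1 / 2) (hcc : 2 * (h + 1) * c ≤ c')
    (hM : (2 * g + 1) * (2 * h + 2) ≤ M) {N : Tournament h} {θ : Equiv.Perm (Fin h)} {m l : ℕ}
    {Q : Fin m → Finset (Fin h)} {ctr : Fin m → Fin h} {Sig : Fin l → Finset (Fin h)}
    {c₁ c₂ : Fin l → Fin h} {L₁ L₂ : Fin l → Finset (Fin h)} {kd : Fin l → NebKind}
    (hN : SuperNebulaDecomp N θ Q ctr Sig c₁ c₂ L₁ L₂ kd)
    (hstars : ∀ i, N.IsFrontierStarAt θ (Q i) (ctr i)) (hkd : ∀ i, kd i = NebKind.middle)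
    (htri : ∀ i j k p oa oc, 2 * g ≤ i → i + 2 * g < j → j + 2 * g < k → k + 2 * g < M →
      oa ∈ insertNone (range (2 * g + h)) → oc ∈ insertNone (range (2 * g + h)) → g ≤ p →
      p < g + h → ∀ x ∈ X i oa, ∀ y ∈ X j (some p), ∀ z ∈ X k oc,
        ¬ (T.adj y x ∧ T.adj z x ∧ T.adj z y)) : T.Contains N := by
  obtain ⟨-, hSig, hQQ, hSS, hQS, hback, hbet, hbetS⟩ := hN
  replace hSig : ∀ i, N.IsSuper2NebulaAt θ (Sig i) (c₁ i) (c₂ i) (L₁ i) (L₂ i) NebKind.middle :=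
    fun i => hkd i ▸ hSig i
  have hSeq : ∀ i, Sig i = insert (c₁ i) (insert (c₂ i) (L₁ i ∪ L₂ i)) :=
    fun i => (hSig i).1.2.2.2.2.2.2.1
  have hc₁S : ∀ i, c₁ i ∈ Sig i := fun i => by simp [hSeq]
  have hc₂S : ∀ i, c₂ i ∈ Sig i := fun i => by simp [hSeq]
  have hLS : ∀ i, ∀ v ∈ L₁ i ∪ L₂ i, v ∈ Sig i := fun i v hv => by
    rw [hSeq]; exact mem_insert_of_mem (mem_insert_of_mem hv)
  have hL₁ : ∀ i, ∀ v ∈ L₁ i ∪ L₂ i, v ≠ c₁ i := fun i v hv hne =>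
    (hSig i).1.2.2.2.1 (hne ▸ hv)
  have hL₂ : ∀ i, ∀ v ∈ L₁ i ∪ L₂ i, v ≠ c₂ i := fun i v hv hne =>
    (hSig i).1.2.2.2.2.1 (hne ▸ hv)
  set Z : Finset (Fin h) := univ.image ctr ∪ (univ.image c₁ ∪ univ.image c₂) with hZdef
  have hctrZ : ∀ i, ctr i ∈ Z := fun i => by simp [hZdef]
  have hc₁Z : ∀ i, c₁ i ∈ Z := fun i => by simp [hZdef]
  have hc₂Z : ∀ i, c₂ i ∈ Z := fun i => by simp [hZdef]
  have hZ : ∀ v ∈ Z, (∃ i, ctr i = v) ∨ (∃ i, c₁ i = v) ∨ ∃ i, c₂ i = v := by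
    intro v hv
    simpa [hZdef] using hv
  have hleafQ : ∀ i, ∀ v ∈ (Q i).erase (ctr i), v ∉ Z := by
    intro i v hv hvZ
    have hvQ := mem_of_mem_erase hv
    rcases hZ v hvZ with ⟨j, rfl⟩ | ⟨j, rfl⟩ | ⟨j, rfl⟩
    · by_cases hij : j = i
      · exact ne_of_mem_erase hv (hij ▸ rfl)
      · exact disjoint_left.1 (hQQ j i hij) (hstars j).center_mem hvQ
    · exact disjoint_left.1 (hQS i j) hvQ (hc₁S j)
    · exact disjoint_left.1 (hQS i j) hvQ (hc₂S j)
  have hleafS : ∀ i, ∀ v ∈ L₁ i ∪ L₂ i, v ∉ Z := by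
    intro i v hv hvZ
    have hvS := hLS i v hv
    rcases hZ v hvZ with ⟨j, rfl⟩ | ⟨j, rfl⟩ | ⟨j, rfl⟩
    · exact disjoint_left.1 (hQS j i) (hstars j).center_mem hvS
    · by_cases hij : j = i
      · exact hL₁ i _ hv (hij ▸ rfl)
      · exact disjoint_left.1 (hSS j i hij) (hc₁S j) hvS
    · by_cases hij : j = i
      · exact hL₂ i _ hv (hij ▸ rfl)
      · exact disjoint_left.1 (hSS j i hij) (hc₂S j) hvS
  have hpl : IsPlacement θ M (2 * g + h) (fun v => (2 * g + 1) * (slot θ Z v + 1))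
      (fun v => if v ∈ Z then none else some (g + pos θ v)) :=
    isPlacement_slot θ Z (by omega) (by nlinarith)
  set idx : Fin h → ℕ := fun v => (2 * g + 1) * (slot θ Z v + 1) with hidx
  set o : Fin h → Option ℕ := fun v => if v ∈ Z then none else some (g + pos θ v) with ho
  have hoZ : ∀ v ∈ Z, o v = none := fun v hv => by simp [ho, hv]
  have ho' : ∀ v, v ∉ Z → o v = some (g + pos θ v) := fun v hv => by simp [ho, hv]
  have htri' : ∀ u v w, idx u < idx v → idx v < idx w → v ∉ Z →
      ∀ x ∈ X (idx u) (o u), ∀ y ∈ X (idx v) (o v), ∀ z ∈ X (idx w) (o w),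
        ¬ (T.adj y x ∧ T.adj z x ∧ T.adj z y) := by
    intro u v w huv hvw hvZ x hx y hy z hz
    rw [ho' v hvZ] at hy
    have huv' := lt_of_mul_lt_mul_left huv (Nat.zero_le _)
    have hvw' := lt_of_mul_lt_mul_left hvw (Nat.zero_le _)
    have hw := slot_lt_two_mul θ Z w
    have hpv := (pos θ v).isLt
    refine htri _ _ _ _ _ _ ?_ ?_ ?_ ?_ (hpl.mem u) (hpl.mem w) (by omega) (by omega)
      x hx y hy z hz <;> simp only [hidx] <;> nlinarith
  have hV : 0 < c * (V.card : ℝ) := mul_pos hc (lt_of_lt_of_le (by positivity) hT.le_card)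
  have hτ : 0 < c * (τ : ℝ) := mul_pos hc (lt_of_lt_of_le (by positivity) hT.le_size)
  have hc' : 0 < c' := lt_of_lt_of_le (by positivity) hcc
  have hV' : 0 < c' * (V.card : ℝ) := mul_pos hc' (pos_of_mul_pos_right hV hc.le)
  have hτ' : 0 < c' * (τ : ℝ) := mul_pos hc' (pos_of_mul_pos_right hτ hc.le)
  have hVn : ∃ x, x ∈ V := card_pos.1 (by exact_mod_cast pos_of_mul_pos_right hV hc.le)
  obtain ⟨x₀, -⟩ := hVn
  refine hX.contains_of_placement hV' hτ' hlam hhlam hpl (Sum.elim Q Sig) ?_ ?_ ∅ (fun _ => x₀)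
    (by simp) (by simp) ?_
  · rintro (i | i) (j | j) hne
    · exact hQQ i j fun hij => hne (congrArg _ hij)
    · exact hQS i j
    · exact (hQS j i).symm
    · exact hSS i j fun hij => hne (congrArg _ hij)
  · intro u v huv
    rcases hback u v huv with ⟨i, h1⟩ | ⟨i, h1⟩
    · exact ⟨Sum.inl i, h1⟩
    · exact ⟨Sum.inr i, h1⟩
  rintro (i | i) - Y hY
  · refine hX.exists_star_embedding hT hc hcc hpl (hstars i) (hoZ _ (hctrZ i))
      (fun v hv => ⟨_, ho' v (hleafQ i v hv)⟩) ?_ hY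
    intro u hu v hv huv hne x hx y hy y' hy'
    have hlt : idx u < idx v := (hpl.lt_or u v huv).resolve_right fun hcon => hne hcon.1
    have hcen : ∀ w, pos θ (ctr i) < pos θ w → idx (ctr i) < idx w := fun w hw =>
      Nat.mul_lt_mul_of_pos_left (Nat.succ_lt_succ (slot_lt_of_mem hw (Or.inl (hctrZ i))))
        (by omega)
    have hcen' : ∀ w, pos θ w < pos θ (ctr i) → idx w < idx (ctr i) := fun w hw =>
      Nat.mul_lt_mul_of_pos_left (Nat.succ_lt_succ (slot_lt_of_mem hw (Or.inr (hctrZ i))))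
        (by omega)
    have hyy : y' ≠ y := fun heq =>
      disjoint_left.1 (hX.disjoint_of_idx_ne hpl hne) hy (heq ▸ hy')
    refine ⟨fun hvz hxy hxy' => T.adj_of_not_adj hyy fun hcon => ?_,
      fun hzu hyx hyx' => T.adj_of_not_adj hyy fun hcon => ?_⟩
    · exact htri' u v (ctr i) hlt (hcen' v hvz) (hleafQ i v hv) y hy y' hy' x hx ⟨hcon, hxy, hxy'⟩
    · exact htri' (ctr i) u v (hcen u hzu) hlt (hleafQ i u hu) x hx y hy y' hy' ⟨hyx, hyx', hcon⟩
  · replace hY : ∀ v ∈ Sig i, Y v ⊆ X (idx v) (o v) ∧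
        ((X (idx v) (o v)).card : ℝ) ≤ 2 * (Y v).card := hY
    have hYsub : ∀ v ∈ Sig i, Y v ⊆ X (idx v) (o v) := fun v hv => (hY v hv).1
    have hc₁lt : ∀ w, pos θ (c₁ i) < pos θ w → idx (c₁ i) < idx w := fun w hw =>
      Nat.mul_lt_mul_of_pos_left (Nat.succ_lt_succ (slot_lt_of_mem hw (Or.inl (hc₁Z i))))
        (by omega)
    have hc₂lt : ∀ w, pos θ w < pos θ (c₂ i) → idx w < idx (c₂ i) := fun w hw =>
      Nat.mul_lt_mul_of_pos_left (Nat.succ_lt_succ (slot_lt_of_mem hw (Or.inr (hc₂Z i))))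
        (by omega)
    have hmid := (hSig i).2.1
    have hd : ∀ u v, u ∈ Sig i → v ∈ Sig i → idx u ≠ idx v → Disjoint (Y u) (Y v) :=
      fun u v hu hv hne =>
        ((hX.disjoint_of_idx_ne hpl hne).mono_left (hYsub u hu)).mono_right (hYsub v hv)
    refine (hSig i).exists_embedding hT hc hc1
      (fun v hv => (hYsub v hv).trans (hX.subset _ (hpl.idx_lt v) _ (hpl.mem v)))
      (hX.large_of_eq_none hpl hcc (hoZ _ (hc₁Z i)) (hY _ (hc₁S i)).2)
      (hX.large_of_eq_none hpl hcc (hoZ _ (hc₂Z i)) (hY _ (hc₂S i)).2)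
      (fun v hv => hX.trans_of_eq_some hpl hc hcc (ho' v (hleafS i v hv)) (hYsub v (hLS i v hv))
        (hY v (hLS i v hv)).2)
      (hd _ _ (hc₁S i) (hc₂S i) (hc₁lt _ (hSig i).1.2.2.2.2.2.2.2).ne)
      (fun v hv => ⟨hd _ _ (hc₁S i) (hLS i v hv) (hc₁lt v (hmid v hv).1).ne,
        hd _ _ (hc₂S i) (hLS i v hv) (hc₂lt v (hmid v hv).2).ne'⟩) ?_ ?_
    · intro u hu v hv huv y hy y' hy'
      refine hX.adj_of_idx_eq hpl huv ?_ (hYsub u (hLS i u hu) hy) (hYsub v (hLS i v hv) hy')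
      have hslot : slot θ Z u = slot θ Z v := by
        refine slot_eq_of_forall huv (hleafS i u hu) (hleafS i v hv) ?_
        rintro w hw ⟨huw, hwv⟩
        have hB : BetweenSet θ (L₁ i ∪ L₂ i) w := ⟨u, hu, v, hv, huw, hwv⟩
        rcases hZ w hw with ⟨j, rfl⟩ | ⟨j, rfl⟩ | ⟨j, rfl⟩
        · exact hbet j i hB
        · by_cases hij : j = i
          · subst hij
            exact absurd huw (hmid u hu).1.not_gt
          · exact (hbetS j i hij).1 hB
        · by_cases hij : j = i
          · subst hij
            exact absurd hwv (hmid v hv).2.not_gt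
          · exact (hbetS j i hij).2 hB
      simp only [hidx, hslot]
    · intro v hv x hx y hy z hz
      exact htri' (c₁ i) v (c₂ i) (hc₁lt v (hmid v hv).1) (hc₂lt v (hmid v hv).2) (hleafS i v hv)
        x (hYsub _ (hc₁S i) hx) y (hYsub _ (hLS i v hv) hy) z (hYsub _ (hc₂S i) hz)

lemma bddAbove_trSizeOn (T : Tournament n) (s : Finset (Fin n)) :
    BddAbove {k | ∃ t, t ⊆ s ∧ T.IsTransOn t ∧ t.card = k} := by
  refine ⟨s.card, ?_⟩
  rintro k ⟨t, hts, -, rfl⟩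
  exact card_le_card hts

lemma IsTransOn.card_le_trSizeOn {T : Tournament n} {s t : Finset (Fin n)} (ht : T.IsTransOn t)
    (hts : t ⊆ s) : t.card ≤ T.trSizeOn s :=
  le_csSup (T.bddAbove_trSizeOn s) ⟨t, hts, ht, rfl⟩

lemma exists_card_eq_trSizeOn (T : Tournament n) (s : Finset (Fin n)) :
    ∃ t ⊆ s, T.IsTransOn t ∧ t.card = T.trSizeOn s :=
  Nat.sSup_mem (s := {k | ∃ t, t ⊆ s ∧ T.IsTransOn t ∧ t.card = k})
    ⟨0, ∅, empty_subset s, fun u hu => absurd hu (notMem_empty u), card_empty⟩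
    (T.bddAbove_trSizeOn s)

lemma exists_criticalAt {c : ℝ} (hc : 0 < c) (hc1 : c ≤ 1 / 2) :
    ∃ ε : ℝ, 0 < ε ∧ ∀ (n : ℕ) (T : Tournament n), (T.trSize : ℝ) < (n : ℝ) ^ ε →
      ∃ V τ, T.CriticalAt V τ c := by
  obtain ⟨K, hK⟩ := exists_nat_ge (1 / c)
  have hK0 : (0 : ℝ) < K := lt_of_lt_of_le (by positivity) hK
  have hlogc : Real.log c < 0 := Real.log_neg hc (by linarith)
  have hlog : Real.log (1 - c / 2) < 0 := Real.log_neg (by linarith) (by linarith)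
  have hε : 0 < min (1 / (K : ℝ)) (Real.log (1 - c / 2) / Real.log c) :=
    lt_min (by positivity) (div_pos_of_neg_of_neg hlog hlogc)
  set ε : ℝ := min (1 / (K : ℝ)) (Real.log (1 - c / 2) / Real.log c) with hεdef
  have hcε : 1 - c / 2 ≤ c ^ ε := by
    have h1 : ε ≤ Real.log (1 - c / 2) / Real.log c := min_le_right _ _
    rw [le_div_iff_of_neg hlogc] at h1
    rw [Real.rpow_def_of_pos hc, ← Real.log_le_iff_le_exp (by linarith), mul_comm]
    exact h1
  refine ⟨ε, hε, fun n T hlt => ?_⟩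
  obtain ⟨V, hV, hmin⟩ := exists_min_image
    (univ.filter fun V : Finset (Fin n) => (T.trSizeOn V : ℝ) < (V.card : ℝ) ^ ε) card
    ⟨univ, mem_filter.2 ⟨mem_univ _, by simpa [trSize] using hlt⟩⟩
  replace hV := (mem_filter.1 hV).2
  obtain ⟨t, htV, ht, htc⟩ := T.exists_card_eq_trSizeOn V
  have hpow : ∀ k, 2 ^ k ≤ V.card → k + 1 ≤ T.trSizeOn V := by
    intro k hk
    obtain ⟨s, hsV, hs, hsk⟩ := T.exists_isTransOn_of_two_pow_le k V hk
    exact hsk.trans (hs.card_le_trSizeOn hsV)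
  have hV0 : V.card ≠ 0 := by
    intro h0
    rw [h0, Nat.cast_zero, Real.zero_rpow hε.ne'] at hV
    exact absurd hV (not_lt.2 (Nat.cast_nonneg _))
  have hV1 : V.card ≠ 1 := by
    intro h1
    rw [h1, Nat.cast_one, Real.one_rpow] at hV
    have h2 := hpow 0 (by omega)
    exact absurd hV (not_lt.2 (by exact_mod_cast h2))
  have hVK : 2 ^ K ≤ V.card := by
    by_contra hcon
    have h2 : (2 : ℝ) ≤ T.trSizeOn V := by exact_mod_cast hpow 1 (by omega)
    have h3 : (V.card : ℝ) ^ ε ≤ (V.card : ℝ) ^ (1 / (K : ℝ)) :=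
      Real.rpow_le_rpow_of_exponent_le (by exact_mod_cast Nat.pos_of_ne_zero hV0) (min_le_left _ _)
    have h4 : (V.card : ℝ) ^ (1 / (K : ℝ)) ≤ ((2 : ℝ) ^ K) ^ (1 / (K : ℝ)) :=
      Real.rpow_le_rpow (Nat.cast_nonneg _) (by exact_mod_cast (not_le.1 hcon).le) (by positivity)
    rw [← Real.rpow_natCast, ← Real.rpow_mul (by norm_num), mul_one_div_cancel hK0.ne',
      Real.rpow_one] at h4
    linarith
  have hτ : 1 / c ≤ T.trSizeOn V := by
    have h1 : (K : ℝ) + 1 ≤ T.trSizeOn V := by exact_mod_cast hpow K hVK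
    linarith
  have hτV : (T.trSizeOn V : ℝ) ≤ V.card := by
    exact_mod_cast htc ▸ card_le_card htV
  refine ⟨V, T.trSizeOn V, fun X hXV hXc => ?_, fun s hs hs' => hs'.card_le_trSizeOn hs, hτ,
    hτ.trans hτV⟩
  by_cases hXV' : X = V
  · subst hXV'
    refine ⟨t, htV, ht, ?_⟩
    rw [htc]
    have : 0 ≤ c / 2 * (T.trSizeOn X : ℝ) := by positivity
    linarith
  · obtain ⟨s, hsX, hs, hsc⟩ := T.exists_card_eq_trSizeOn X
    refine ⟨s, hsX, hs, ?_⟩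
    have hXlt : X.card < V.card := card_lt_card (hXV.ssubset_of_ne hXV')
    have h1 : (X.card : ℝ) ^ ε ≤ T.trSizeOn X := by
      by_contra hcon
      exact absurd (hmin X (mem_filter.2 ⟨mem_univ _, not_le.1 hcon⟩)) (not_le.2 hXlt)
    have h2 : (c * V.card) ^ ε ≤ (X.card : ℝ) ^ ε :=
      Real.rpow_le_rpow (by positivity) hXc hε.le
    rw [Real.mul_rpow hc.le (Nat.cast_nonneg _)] at h2
    rw [hsc]
    calc (1 - c / 2) * (T.trSizeOn V : ℝ) ≤ c ^ ε * (V.card : ℝ) ^ ε := by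
          apply mul_le_mul hcε hV.le (Nat.cast_nonneg _) (Real.rpow_nonneg hc.le _)
      _ ≤ T.trSizeOn X := h2.trans h1
end Auxiliary

end Tournament

theorem stmt4 {n₁ n₂ : ℕ} (Nb : Tournament n₁) (θ : Equiv.Perm (Fin n₁))
    {m l : ℕ} (Q : Fin m → Finset (Fin n₁)) (ctr : Fin m → Fin n₁)
    (Sig : Fin l → Finset (Fin n₁)) (c₁ c₂ : Fin l → Fin n₁)
    (L₁ L₂ : Fin l → Finset (Fin n₁)) (kd : Fin l → NebKind)
    (hN : SuperNebulaDecomp Nb θ Q ctr Sig c₁ c₂ L₁ L₂ kd)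
    (hstars : ∀ i, Nb.IsFrontierStarAt θ (Q i) (ctr i))
    (hkd : ∀ i, kd i = NebKind.middle)
    (G : Tournament n₂) (α : Equiv.Perm (Fin n₂)) (a b c : Fin n₂)
    {k : ℕ} (QG : Fin k → Finset (Fin n₂)) (ctrG : Fin k → Fin n₂)
    (hG : TriGalaxyDecomp G α (fun _ : Fin 1 => a) (fun _ => b) (fun _ => c) QG ctrG
      (fun _ => ({a, c} : Finset (Fin n₂)))) :
    EHPair Nb G := by
  have hn : (0 : ℝ) < n₁ + n₂ + 1 := by positivity
  set lam : ℝ := 1 / (2 * (n₁ + n₂ + 1)) with hlamdef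
  have hlam : 0 < lam := by positivity
  have hlam1 : lam ≤ 1 := by
    rw [hlamdef, div_le_one (by positivity)]
    linarith
  have hlamn : (n₁ + n₂ + 1) * lam = 1 / 2 := by
    rw [hlamdef]; field_simp
  have hn₁ : 0 ≤ (n₁ : ℝ) * lam := by positivity
  have hn₂ : 0 ≤ (n₂ : ℝ) * lam := by positivity
  obtain ⟨c', hc', hc'1, hscaf⟩ := exists_scaffold Nb hlam hlam1 ((2 * n₂ + 1) * (2 * n₁ + 2))
    (2 * n₂ + n₁)
  set e : ℝ := c' / (2 * (n₁ + n₂ + 1)) with hedef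
  have he : 0 < e := by positivity
  have hee : 2 * (n₁ + n₂ + 1) * e = c' := by
    rw [hedef]; field_simp
  have he₁ : 0 ≤ (n₁ : ℝ) * e := by positivity
  have he₂ : 0 ≤ (n₂ : ℝ) * e := by positivity
  have he2 : e ≤ 1 / 2 := by nlinarith
  obtain ⟨ε, hε, hcrit⟩ := exists_criticalAt he he2
  refine ⟨ε, hε, fun n T hTN hTG => ?_⟩
  by_contra hcon
  obtain ⟨V, τ, hT⟩ := hcrit n T (not_le.1 hcon)
  obtain ⟨X, hX⟩ := hscaf e he (by linarith) n T V τ hT hTN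
  refine hTN (hX.contains_superNebula hT he he2 hlam.le (by linarith) (by linarith) le_rfl hN hstars
    hkd ?_)
  intro i j k p oa oc hi hij hjk hkM hoa hoc hp hpq x hx y hy z hz
  exact hX.no_triangle hT he hlam.le (by linarith) (by linarith) hG hTG hi hij hjk hkM hoa hoc hp
    hpq hx hy hz
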